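/- arXiv:1209.1804 — 7 statements merged into one kernel-verified Lean document; each statement's English description precedes it below -/
import Mathlib

section
/- Let (E, m) be a σ-finite measure space, let n ≥ 2, and let w_1, …, w_n : E × E → ℂ be measurable functions each square-integrable with respect to m ⊗ m. Then, with the cyclic convention x_0 = x_n, the iterated integral ∫⋯∫ ∏_{j=1}^n |w_j(x_j, x_{j−1})| dm(x_1)⋯dm(x_n) is at most ∏_{j=1}^n (∫∫ |w_j(x,y)|² dm(x) dm(y))^{1/2}. -/
open MeasureTheory ENNReal

/-- The `L²` norm of a nonnegative kernel on `E × E`. -/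
noncomputable def kernelNorm {E : Type*} [MeasurableSpace E] (m : Measure E)
    (f : E × E → ℝ≥0∞) : ℝ≥0∞ :=
  (∫⁻ p, f p ^ 2 ∂(m.prod m)) ^ (1 / 2 : ℝ)

theorem lintegral_mul_le_sqrt {α : Type*} [MeasurableSpace α] (μ : Measure α)
    {f g : α → ℝ≥0∞} (hf : Measurable f) (hg : Measurable g) :
    ∫⁻ a, f a * g a ∂μ
      ≤ (∫⁻ a, f a ^ 2 ∂μ) ^ (1 / 2 : ℝ) * (∫⁻ a, g a ^ 2 ∂μ) ^ (1 / 2 : ℝ) := by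
  simpa using ENNReal.lintegral_mul_le_Lp_mul_Lq μ Real.HolderConjugate.two_two
    hf.aemeasurable hg.aemeasurable

theorem sq_lintegral_mul_le {α : Type*} [MeasurableSpace α] (μ : Measure α)
    {f g : α → ℝ≥0∞} (hf : Measurable f) (hg : Measurable g) :
    (∫⁻ a, f a * g a ∂μ) ^ 2 ≤ (∫⁻ a, f a ^ 2 ∂μ) * ∫⁻ a, g a ^ 2 ∂μ := by
  calc (∫⁻ a, f a * g a ∂μ) ^ 2
      ≤ ((∫⁻ a, f a ^ 2 ∂μ) ^ (1 / 2 : ℝ) * (∫⁻ a, g a ^ 2 ∂μ) ^ (1 / 2 : ℝ)) ^ 2 := by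
        gcongr
        exact lintegral_mul_le_sqrt μ hf hg
    _ = _ := by
        rw [mul_pow, ← ENNReal.rpow_natCast, ← ENNReal.rpow_natCast, ← ENNReal.rpow_mul,
          ← ENNReal.rpow_mul]
        norm_num

section

variable {E : Type*} [MeasurableSpace E] (m : Measure E) [SigmaFinite m]

theorem measurable_kernel_comp {f g : E × E → ℝ≥0∞} (hf : Measurable f) (hg : Measurable g) :
    Measurable fun p : E × E => ∫⁻ t, f (p.1, t) * g (t, p.2) ∂m := by
  apply Measurable.lintegral_prod_right'
    (f := fun q : (E × E) × E => f (q.1.1, q.2) * g (q.2, q.1.2))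
  fun_prop

theorem kernelNorm_comp_le {f g : E × E → ℝ≥0∞} (hf : Measurable f) (hg : Measurable g) :
    kernelNorm m (fun p => ∫⁻ t, f (p.1, t) * g (t, p.2) ∂m)
      ≤ kernelNorm m f * kernelNorm m g := by
  unfold kernelNorm
  rw [← ENNReal.mul_rpow_of_nonneg _ _ (by norm_num)]
  gcongr
  calc ∫⁻ p, (∫⁻ t, f (p.1, t) * g (t, p.2) ∂m) ^ 2 ∂(m.prod m)
      ≤ ∫⁻ p, (∫⁻ t, f (p.1, t) ^ 2 ∂m) * ∫⁻ t, g (t, p.2) ^ 2 ∂m ∂(m.prod m) := by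
        gcongr with p
        exact sq_lintegral_mul_le m (f := fun t => f (p.1, t)) (g := fun t => g (t, p.2))
          (by fun_prop) (by fun_prop)
    _ = (∫⁻ x, ∫⁻ t, f (x, t) ^ 2 ∂m ∂m) * ∫⁻ y, ∫⁻ t, g (t, y) ^ 2 ∂m ∂m :=
        lintegral_prod_mul (hf.pow_const 2).lintegral_prod_right'.aemeasurable
          (hg.pow_const 2).lintegral_prod_left'.aemeasurable
    _ = _ := by
        rw [lintegral_prod _ (hf.pow_const 2).aemeasurable,
          lintegral_prod_symm _ (hg.pow_const 2).aemeasurable]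

theorem lintegral_cycle_le (n : ℕ) (g : E × E → ℝ≥0∞) (f : Fin (n + 1) → E × E → ℝ≥0∞)
    (hg : Measurable g) (hf : ∀ i, Measurable (f i)) :
    ∫⁻ x : Fin (n + 2) → E, g (x 0, x (Fin.last (n + 1))) *
        ∏ i : Fin (n + 1), f i (x i.succ, x i.castSucc) ∂(Measure.pi fun _ => m)
      ≤ kernelNorm m g * ∏ i, kernelNorm m (f i) := by
  induction n generalizing g with
  | zero =>
    have h := (measurePreserving_finTwoArrow m).lintegral_comp
      (f := fun p : E × E => g p * f 0 p.swap) (hg.mul ((hf 0).comp measurable_swap))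
    have hs : kernelNorm m (f 0) = (∫⁻ p, f 0 (p.swap) ^ 2 ∂(m.prod m)) ^ (1 / 2 : ℝ) := by
      rw [kernelNorm, lintegral_prod_swap (fun p => f 0 p ^ 2)]
    simp only [Fin.prod_univ_succ (n := 0), Fin.prod_univ_zero, mul_one]
    rw [hs]
    refine le_trans (le_of_eq h) ?_
    exact lintegral_mul_le_sqrt _ hg ((hf 0).comp measurable_swap)
  | succ n ih =>
    have hlast := hf (Fin.last (n + 1))
    let F : E × (Fin (n + 2) → E) → ℝ≥0∞ := fun p =>
      (∏ i : Fin (n + 1), f i.castSucc (p.2 i.succ, p.2 i.castSucc)) *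
        (g (p.2 0, p.1) * f (Fin.last (n + 1)) (p.1, p.2 (Fin.last (n + 1))))
    have hprod : Measurable fun y : Fin (n + 2) → E =>
        ∏ i : Fin (n + 1), f i.castSucc (y i.succ, y i.castSucc) :=
      Finset.measurable_fun_prod _ fun i _ => (hf i.castSucc).comp (by fun_prop)
    have hF : Measurable F := by
      refine (hprod.comp measurable_snd).mul ?_
      fun_prop
    have h := (measurePreserving_piFinSuccAbove (fun _ : Fin (n + 3) => m)
      (Fin.last (n + 2))).lintegral_comp hF
    calc _ = _ := by
          refine Eq.trans (lintegral_congr fun x => ?_) h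
          simp only [F, MeasurableEquiv.piFinSuccAbove_apply, Fin.insertNthEquiv_symm_apply,
            Fin.removeNth, Fin.succAbove_last]
          rw [Fin.prod_univ_castSucc]
          simp only [Fin.succ_last, Fin.succ_castSucc, Fin.castSucc_zero]
          ring
      _ = ∫⁻ y : Fin (n + 2) → E,
            (∫⁻ t, g (y 0, t) * f (Fin.last (n + 1)) (t, y (Fin.last (n + 1))) ∂m) *
              ∏ i : Fin (n + 1), f i.castSucc (y i.succ, y i.castSucc)
            ∂(Measure.pi fun _ => m) := by
          rw [lintegral_prod_symm _ hF.aemeasurable]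
          refine lintegral_congr fun y => ?_
          simp only [F]
          rw [lintegral_const_mul _ (by fun_prop), mul_comm]
      _ ≤ _ := ih (fun p => ∫⁻ t, g (p.1, t) * f (Fin.last (n + 1)) (t, p.2) ∂m)
          (fun i => f i.castSucc) (measurable_kernel_comp m hg hlast) fun i => hf _
      _ ≤ (kernelNorm m g * kernelNorm m (f (Fin.last (n + 1)))) *
            ∏ i : Fin (n + 1), kernelNorm m (f i.castSucc) := by
          gcongr
          exact kernelNorm_comp_le m hg hlast
      _ = _ := by
          rw [Fin.prod_univ_castSucc (n := n + 1)]
          ring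

end

/-- Cyclic Cauchy–Schwarz inequality (32.2q): for measurable, square-integrable
kernels `w j : E × E → ℂ` on a σ-finite measure space `(E, m)` and `n ≥ 2`,
with the cyclic convention `x 0 = x n`, the iterated integral of
`∏ j |w j (x j, x (j-1))|` is bounded by `∏ j (∫∫ |w j|² dm dm)^{1/2}`. -/
theorem stmt_0
    {E : Type*} [MeasurableSpace E] (m : Measure E) [SigmaFinite m]
    (n : ℕ) (hn : 2 ≤ n) [NeZero n]
    (w : Fin n → E × E → ℂ)
    (hw_meas : ∀ j, Measurable (w j))
    (hw_sq : ∀ j, ∫⁻ p, (‖w j p‖₊ : ℝ≥0∞) ^ 2 ∂(m.prod m) < ⊤) :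
    ∫⁻ x : Fin n → E, ∏ j, (‖w j (x j, x (j - 1))‖₊ : ℝ≥0∞)
        ∂(Measure.pi fun _ => m)
      ≤ ∏ j, (∫⁻ p, (‖w j p‖₊ : ℝ≥0∞) ^ 2 ∂(m.prod m)) ^ (1 / 2 : ℝ) := by
  obtain ⟨k, rfl⟩ := Nat.exists_eq_add_of_le' hn
  have hmeas : ∀ j, Measurable fun p => (‖w j p‖₊ : ℝ≥0∞) := fun j => by
    have := hw_meas j
    fun_prop
  have h := lintegral_cycle_le m k (fun p => (‖w 0 p‖₊ : ℝ≥0∞))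
    (fun i p => (‖w i.succ p‖₊ : ℝ≥0∞)) (hmeas 0) fun i => hmeas _
  have hzero : (0 : Fin (k + 2)) - 1 = Fin.last (k + 1) := by
    rw [sub_eq_iff_eq_add, Fin.last_add_one]
  have hsucc : ∀ i : Fin (k + 1), i.succ - 1 = i.castSucc := fun i => by
    rw [sub_eq_iff_eq_add, Fin.coeSucc_eq_succ]
  simp only [Fin.prod_univ_succ (n := k + 1), hzero, hsucc]
  exact h
end

section
/- Let u : ℝ^d → ℝ be an integrable function whose Fourier transform û is also integrable, and assume u(z) = (2π)^{−d} ∫ e^{i⟨z,ξ⟩} û(ξ) dξ for all z (e.g. u continuous). Set γ = |û| ∗ |û|, i.e. γ(ξ) = ∫ |û(ξ−η)| |û(η)| dη. Then for every n ≥ 2 and all finite signed Borel measures ν_1, …, ν_n on ℝ^d one has, with z_{n+1} = z_1, |∫⋯∫ ∏_{j=1}^n u(z_{j+1} − z_j) ∏_{j=1}^n dν_j(z_j)| ≤ ∏_{j=1}^n ((2π)^{−d} ∫ |ν̂_j(ξ)|² γ(ξ) dξ)^{1/2}. -/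
open MeasureTheory ENNReal
open scoped RealInnerProductSpace

section HilbertSchmidt

variable {X : Type*} [MeasurableSpace X]

/-- The Hilbert–Schmidt norm of a nonnegative kernel. -/
noncomputable def hilbertSchmidtNorm (μ : Measure X) (K : X × X → ℝ≥0∞) : ℝ≥0∞ :=
  (∫⁻ p, K p ^ 2 ∂μ.prod μ) ^ (1 / 2 : ℝ)

theorem lintegral_mul_le_sqrt_mul_sqrt {Y : Type*} [MeasurableSpace Y] (μ : Measure Y)
    {f g : Y → ℝ≥0∞} (hf : Measurable f) (hg : Measurable g) :
    ∫⁻ y, f y * g y ∂μ ≤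
      (∫⁻ y, f y ^ 2 ∂μ) ^ (1 / 2 : ℝ) * (∫⁻ y, g y ^ 2 ∂μ) ^ (1 / 2 : ℝ) := by
  simpa using ENNReal.lintegral_mul_le_Lp_mul_Lq μ Real.HolderConjugate.two_two
    hf.aemeasurable hg.aemeasurable

theorem hilbertSchmidtNorm_comp_le (μ : Measure X) [SigmaFinite μ] {K H : X × X → ℝ≥0∞}
    (hK : Measurable K) (hH : Measurable H) :
    hilbertSchmidtNorm μ (fun p ↦ ∫⁻ b, K (p.1, b) * H (b, p.2) ∂μ) ≤
      hilbertSchmidtNorm μ K * hilbertSchmidtNorm μ H := by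
  unfold hilbertSchmidtNorm
  rw [← ENNReal.mul_rpow_of_nonneg _ _ (by norm_num)]
  gcongr
  have hK2 : Measurable fun p ↦ K p ^ 2 := hK.pow_const 2
  have hH2 : Measurable fun p ↦ H p ^ 2 := hH.pow_const 2
  calc ∫⁻ p, (∫⁻ b, K (p.1, b) * H (b, p.2) ∂μ) ^ 2 ∂μ.prod μ
      ≤ ∫⁻ p, (∫⁻ b, K (p.1, b) ^ 2 ∂μ) * ∫⁻ b, H (b, p.2) ^ 2 ∂μ ∂μ.prod μ := by
        gcongr with p
        refine (pow_le_pow_left' (lintegral_mul_le_sqrt_mul_sqrt μ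
          (f := fun b ↦ K (p.1, b)) (g := fun b ↦ H (b, p.2)) (by fun_prop) (by fun_prop)) 2).trans ?_
        rw [mul_pow, ← ENNReal.rpow_mul_natCast, ← ENNReal.rpow_mul_natCast]
        simp
    _ = (∫⁻ p, K p ^ 2 ∂μ.prod μ) * ∫⁻ p, H p ^ 2 ∂μ.prod μ := by
        rw [lintegral_prod_mul (f := fun a ↦ ∫⁻ b, K (a, b) ^ 2 ∂μ)
          (g := fun c ↦ ∫⁻ b, H (b, c) ^ 2 ∂μ) hK2.lintegral_prod_right'.aemeasurable
          hH2.lintegral_prod_left'.aemeasurable, lintegral_prod _ hK2.aemeasurable,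
          lintegral_prod_symm _ hH2.aemeasurable]

/-- Cauchy–Schwarz inequality for a cyclic chain of kernels. -/
theorem lintegral_chain_le (μ : Measure X) [SigmaFinite μ] (m : ℕ)
    {K : Fin (m + 1) → X × X → ℝ≥0∞} (hK : ∀ i, Measurable (K i))
    {H : X × X → ℝ≥0∞} (hH : Measurable H) :
    ∫⁻ x : Fin (m + 2) → X, (∏ i : Fin (m + 1), K i (x i.castSucc, x i.succ)) *
        H (x (Fin.last _), x 0) ∂Measure.pi (fun _ ↦ μ) ≤
      (∏ i, hilbertSchmidtNorm μ (K i)) * hilbertSchmidtNorm μ H := by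
  induction m generalizing H with
  | zero =>
    have h0 := hK 0
    calc _ = ∫⁻ p : X × X, K 0 p * H p.swap ∂μ.prod μ := by
          rw [← (measurePreserving_finTwoArrow μ).lintegral_comp_emb
            (MeasurableEquiv.measurableEmbedding _)]
          simp [MeasurableEquiv.finTwoArrow]
      _ ≤ _ := by
          refine (lintegral_mul_le_sqrt_mul_sqrt _ h0 (by fun_prop)).trans_eq ?_
          rw [lintegral_prod_swap (μ := μ) (ν := μ) (fun p ↦ H p ^ 2)]
          simp [hilbertSchmidtNorm]
  | succ m ih =>
    have hlast := hK (Fin.last _)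
    calc _ = ∫⁻ y : Fin (m + 2) → X, ∫⁻ t, (∏ i : Fin (m + 1), K i.castSucc (y i.castSucc, y i.succ)) *
            (K (Fin.last _) (y (Fin.last _), t) * H (t, y 0)) ∂μ ∂Measure.pi (fun _ ↦ μ) := by
          rw [← ((measurePreserving_piFinSuccAbove (fun _ : Fin (m + 3) ↦ μ)
            (Fin.last _)).symm).lintegral_comp_emb (MeasurableEquiv.measurableEmbedding _),
            lintegral_prod_symm']
          · refine lintegral_congr fun y ↦ lintegral_congr fun t ↦ ?_
            simp only [MeasurableEquiv.piFinSuccAbove_symm_apply, Fin.insertNthEquiv,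
              Fin.prod_univ_castSucc (n := m + 1), Equiv.coe_fn_mk, Fin.insertNth_last',
              Fin.succ_castSucc, Fin.snoc_castSucc, Fin.succ_last, Fin.snoc_last, mul_assoc]
            congr 4
          · fun_prop
      _ = ∫⁻ y : Fin (m + 2) → X, (∏ i : Fin (m + 1), K i.castSucc (y i.castSucc, y i.succ)) *
            (fun p : X × X ↦ ∫⁻ t, K (Fin.last _) (p.1, t) * H (t, p.2) ∂μ)
              (y (Fin.last _), y 0) ∂Measure.pi (fun _ ↦ μ) := by
          refine lintegral_congr fun y ↦ ?_
          rw [lintegral_const_mul _ (by fun_prop)]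
      _ ≤ _ := by
          refine (ih (fun i ↦ hK _) (Measurable.lintegral_prod_right' (ν := μ) (f := fun q : (X × X) × X ↦
            K (Fin.last _) (q.1.1, q.2) * H (q.2, q.1.2)) (by fun_prop))).trans ?_
          rw [Fin.prod_univ_castSucc (n := m + 1), mul_assoc]
          gcongr
          exact hilbertSchmidtNorm_comp_le μ hlast hH

end HilbertSchmidt

section Fourier

open scoped ContDiff FourierTransform

variable {V : Type*} [NormedAddCommGroup V] [InnerProductSpace ℝ V] [FiniteDimensional ℝ V]
  [MeasurableSpace V] [BorelSpace V]

/-- The Fourier transform is injective on integrable functions. -/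
theorem ae_eq_zero_of_fourier_eq_zero {g : V → ℂ} (hg : Integrable g) (h : ∀ w, 𝓕 g w = 0) :
    ∀ᵐ x, g x = 0 := by
  refine ae_eq_zero_of_integral_contDiff_smul_eq_zero hg.locallyIntegrable fun φ hφ hφc ↦ ?_
  have hc : HasCompactSupport (Complex.ofRealCLM ∘ φ) := hφc.comp_left rfl
  have hs : ContDiff ℝ ∞ (Complex.ofRealCLM ∘ φ) := by fun_prop
  set ψ := hc.toSchwartzMap hs
  have key := VectorFourier.integral_fourierIntegral_smul_eq_flip (L := innerₗ V)
    (f := (𝓕⁻ ψ : SchwartzMap V ℂ)) (g := g) (μ := volume) (ν := volume)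
    Real.continuous_fourierChar continuous_inner (𝓕⁻ ψ : SchwartzMap V ℂ).integrable hg
  have h1 : VectorFourier.fourierIntegral Real.fourierChar volume (innerₗ V)
      (𝓕⁻ ψ : SchwartzMap V ℂ) = ψ := by
    have : (𝓕 (𝓕⁻ ψ : SchwartzMap V ℂ) : SchwartzMap V ℂ) = ψ := by simp
    exact congrArg DFunLike.coe this
  have h2 : ∀ x, VectorFourier.fourierIntegral Real.fourierChar volume (innerₗ V).flip g x = 0 := by
    intro x
    rw [flip_innerₗ]
    exact h x
  simp only [h1, h2, smul_zero, integral_zero] at key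
  simpa [ψ] using key

theorem norm_neg_ae_eq_of_integral_real {g : V → ℂ} (hg : Integrable g)
    (h : ∀ z : V, (∫ ξ, Complex.exp (Complex.I * ((⟪z, ξ⟫ : ℝ) : ℂ)) * g ξ).im = 0) :
    ∀ᵐ ξ, ‖g (-ξ)‖ = ‖g ξ‖ := by
  have hg' : Integrable fun ξ ↦ (starRingEnd ℂ) (g (-ξ)) :=
    (Complex.conjCLE : ℂ →L[ℝ] ℂ).integrable_comp hg.comp_neg
  have hexp (z : V) {k : V → ℂ} (hk : Integrable k) :
      Integrable fun ξ ↦ Complex.exp (Complex.I * ((⟪z, ξ⟫ : ℝ) : ℂ)) * k ξ := by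
    refine hk.bdd_mul (c := 1) (by fun_prop) (.of_forall fun ξ ↦ ?_)
    rw [mul_comm, Complex.norm_exp_ofReal_mul_I]
  have h0 := ae_eq_zero_of_fourier_eq_zero (hg.sub hg') fun w ↦ ?_
  · filter_upwards [h0] with ξ hξ
    rw [sub_eq_zero.1 hξ]
    simp
  · set z := (-(2 * Real.pi)) • w with hz
    have : 𝓕 (g - fun ξ ↦ (starRingEnd ℂ) (g (-ξ))) w =
        (∫ ξ, Complex.exp (Complex.I * ((⟪z, ξ⟫ : ℝ) : ℂ)) * g ξ) -
        ∫ ξ, Complex.exp (Complex.I * ((⟪z, ξ⟫ : ℝ) : ℂ)) * (starRingEnd ℂ) (g (-ξ)) := by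
      rw [← integral_sub (hexp z hg) (hexp z hg'), Real.fourier_eq']
      congr 1 with ξ
      rw [hz, real_inner_smul_left, real_inner_comm, Pi.sub_apply, smul_eq_mul, mul_sub]
      ring_nf
    rw [this, ← integral_neg_eq_self
      (fun ξ ↦ Complex.exp (Complex.I * ((⟪z, ξ⟫ : ℝ) : ℂ)) * (starRingEnd ℂ) (g (-ξ)))]
    have : ∀ ξ, Complex.exp (Complex.I * ((⟪z, -ξ⟫ : ℝ) : ℂ)) * (starRingEnd ℂ) (g (- -ξ)) =
        (starRingEnd ℂ) (Complex.exp (Complex.I * ((⟪z, ξ⟫ : ℝ) : ℂ)) * g ξ) := by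
      intro ξ
      rw [map_mul, ← Complex.exp_conj, neg_neg, inner_neg_right]
      simp
    simp_rw [this]
    rw [integral_conj, sub_eq_zero, eq_comm, Complex.conj_eq_iff_im]
    exact h z

end Fourier

section CyclicSums

variable {V : Type*} [NormedAddCommGroup V] [InnerProductSpace ℝ V]

theorem sum_inner_cyclic {n : ℕ} [NeZero n] (x ξ : Fin n → V) :
    ∑ j, ⟪x (j + 1) - x j, ξ j⟫ = -∑ j, ⟪ξ (j + 1) - ξ j, x (j + 1)⟫ := by
  have h : ∑ j, ⟪ξ (j + 1), x (j + 1)⟫ = ∑ j, ⟪ξ j, x j⟫ :=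
    Equiv.sum_comp (Equiv.addRight (1 : Fin n)) (fun j ↦ ⟪ξ j, x j⟫)
  simp only [inner_sub_left, Finset.sum_sub_distrib, h]
  simp only [real_inner_comm]
  ring

theorem prod_exp_cyclic {n : ℕ} [NeZero n] (x ξ : Fin n → V) :
    ∏ j, Complex.exp (Complex.I * ((⟪x (j + 1) - x j, ξ j⟫ : ℝ) : ℂ)) =
      ∏ j, Complex.exp (-(Complex.I * ((⟪ξ (j + 1) - ξ j, x (j + 1)⟫ : ℝ) : ℂ))) := by
  rw [← Complex.exp_sum, ← Complex.exp_sum]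
  congr 1
  rw [← Finset.mul_sum, ← Complex.ofReal_sum, sum_inner_cyclic, Finset.sum_neg_distrib,
    ← Finset.mul_sum]
  push_cast
  ring

end CyclicSums

section SymmetrizedKernel

variable {V : Type*} [NormedAddCommGroup V]

/-- The kernel `|v(a)|^{1/2} |v(b)|^{1/2} |N(b - a)|`. -/
noncomputable def symmetrizedKernel (v N : V → ℂ) (p : V × V) : ℝ≥0∞ :=
  ‖v p.1‖ₑ ^ (1 / 2 : ℝ) * ‖v p.2‖ₑ ^ (1 / 2 : ℝ) * ‖N (p.2 - p.1)‖ₑ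

theorem prod_symmetrizedKernel {n : ℕ} [NeZero n] (v : V → ℂ) (N : Fin n → V → ℂ)
    (ξ : Fin n → V) :
    ∏ j, symmetrizedKernel v (N j) (ξ j, ξ (j + 1)) =
      ∏ j, ‖v (ξ j)‖ₑ * ‖N j (ξ (j + 1) - ξ j)‖ₑ := by
  have hshift : ∏ j, ‖v (ξ (j + 1))‖ₑ ^ (1 / 2 : ℝ) = ∏ j, ‖v (ξ j)‖ₑ ^ (1 / 2 : ℝ) :=
    Equiv.prod_comp (Equiv.addRight (1 : Fin n)) fun j ↦ ‖v (ξ j)‖ₑ ^ (1 / 2 : ℝ)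
  simp only [symmetrizedKernel, Finset.prod_mul_distrib, hshift]
  congr 1
  rw [← Finset.prod_mul_distrib]
  refine Finset.prod_congr rfl fun j _ ↦ ?_
  rw [← ENNReal.rpow_add_of_nonneg _ _ (by norm_num) (by norm_num)]
  norm_num

end SymmetrizedKernel

section CyclicFourier

variable {V : Type*} [NormedAddCommGroup V] [InnerProductSpace ℝ V] [MeasurableSpace V]

/-- The Fourier transform, with kernel `e^{-i⟨ξ,z⟩}`, of the signed measure `f • μ`. -/
noncomputable def signedFourier (μ : Measure V) (f : V → ℝ) (ξ : V) : ℂ :=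
  ∫ z, Complex.exp (-(Complex.I * ((⟪ξ, z⟫ : ℝ) : ℂ))) * (f z : ℂ) ∂μ

theorem norm_signedFourier_le (μ : Measure V) [IsFiniteMeasure μ] {f : V → ℝ}
    (hf : ∀ x, |f x| = 1) (ξ : V) : ‖signedFourier μ f ξ‖ ≤ μ.real Set.univ := by
  have := norm_integral_le_of_norm_le_const (μ := μ) (C := 1)
    (f := fun z ↦ Complex.exp (-(Complex.I * ((⟪ξ, z⟫ : ℝ) : ℂ))) * (f z : ℂ))
    (.of_forall fun z ↦ by simp [Complex.norm_exp, hf])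
  simpa [signedFourier] using this

variable [FiniteDimensional ℝ V] [BorelSpace V]

theorem measurable_signedFourier (μ : Measure V) [SFinite μ] {f : V → ℝ} (hf : Measurable f) :
    Measurable (signedFourier μ f) := by
  refine (StronglyMeasurable.integral_prod_right' (ν := μ) (f := fun p : V × V ↦
    Complex.exp (-(Complex.I * ((⟪p.1, p.2⟫ : ℝ) : ℂ))) * (f p.2 : ℂ)) ?_).measurable
  exact Measurable.stronglyMeasurable (by fun_prop)

theorem integral_cyclic_eq {n : ℕ} [NeZero n] {v : V → ℂ} (hv : Measurable v)
    (hvi : Integrable v) (μ : Fin n → Measure V) [∀ j, IsFiniteMeasure (μ j)]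
    {f : Fin n → V → ℝ} (hfm : ∀ j, Measurable (f j)) (hf : ∀ j x, |f j x| = 1) :
    ∫ x : Fin n → V, (∏ j, ∫ ξ, Complex.exp (Complex.I * ((⟪x (j + 1) - x j, ξ⟫ : ℝ) : ℂ)) * v ξ) *
        ∏ j, (f j (x j) : ℂ) ∂Measure.pi μ =
      ∫ ξ : Fin n → V, ∏ j, v (ξ j) * signedFourier (μ (j + 1)) (f (j + 1)) (ξ (j + 1) - ξ j) := by
  have hint : Integrable (fun p : (Fin n → V) × (Fin n → V) ↦
      (∏ j, Complex.exp (Complex.I * ((⟪p.1 (j + 1) - p.1 j, p.2 j⟫ : ℝ) : ℂ)) * v (p.2 j)) *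
        ∏ j, (f j (p.1 j) : ℂ)) ((Measure.pi μ).prod volume) := by
    have h1 : Integrable (fun p : (Fin n → V) × (Fin n → V) ↦ (1 : ℂ) * ∏ j, v (p.2 j))
        ((Measure.pi μ).prod volume) :=
      (integrable_const (1 : ℂ)).mul_prod (Integrable.fintype_prod fun _ ↦ hvi)
    refine h1.mono (Measurable.aestronglyMeasurable (by fun_prop)) (.of_forall fun p ↦ ?_)
    simp [hf]
  calc _ = ∫ x : Fin n → V, (∫ ξ : Fin n → V,
        (∏ j, Complex.exp (Complex.I * ((⟪x (j + 1) - x j, ξ j⟫ : ℝ) : ℂ)) * v (ξ j)) *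
          ∏ j, (f j (x j) : ℂ)) ∂Measure.pi μ := by
        refine integral_congr_ae (.of_forall fun x ↦ ?_)
        simp only
        rw [integral_mul_const, ← integral_fintype_prod_volume_eq_prod (fun (j : Fin n) (ξ : V) ↦
          Complex.exp (Complex.I * ((⟪x (j + 1) - x j, ξ⟫ : ℝ) : ℂ)) * v ξ)]
    _ = ∫ ξ : Fin n → V, ∫ x : Fin n → V,
        (∏ j, Complex.exp (Complex.I * ((⟪x (j + 1) - x j, ξ j⟫ : ℝ) : ℂ)) * v (ξ j)) *
          ∏ j, (f j (x j) : ℂ) ∂Measure.pi μ := integral_integral_swap hint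
    _ = _ := by
        refine integral_congr_ae (.of_forall fun ξ ↦ ?_)
        simp only [signedFourier, Finset.prod_mul_distrib]
        have hshift (F : Fin n → ℂ) : ∏ j, F (j + 1) = ∏ j, F j :=
          Equiv.prod_comp (Equiv.addRight (1 : Fin n)) F
        have hre : ∏ j, ∫ z, Complex.exp (-(Complex.I * ((⟪ξ (j + 1) - ξ j, z⟫ : ℝ) : ℂ))) *
              (f (j + 1) z : ℂ) ∂μ (j + 1) =
            ∏ j, ∫ z, Complex.exp (-(Complex.I * ((⟪ξ j - ξ (j - 1), z⟫ : ℝ) : ℂ))) *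
              (f j z : ℂ) ∂μ j := by
          refine Eq.trans ?_ (hshift _)
          simp only [add_sub_cancel_right]
        rw [hre, ← integral_fintype_prod_eq_prod (μ := μ) (fun (j : Fin n) (z : V) ↦
          Complex.exp (-(Complex.I * ((⟪ξ j - ξ (j - 1), z⟫ : ℝ) : ℂ))) * (f j z : ℂ)),
          ← integral_const_mul]
        refine integral_congr_ae (.of_forall fun x ↦ ?_)
        simp only
        rw [prod_exp_cyclic, Finset.prod_mul_distrib,
          ← hshift fun j ↦ Complex.exp (-(Complex.I * ((⟪ξ j - ξ (j - 1), x j⟫ : ℝ) : ℂ)))]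
        simp only [add_sub_cancel_right]
        ring

theorem measurable_symmetrizedKernel {v N : V → ℂ} (hv : Measurable v) (hN : Measurable N) :
    Measurable (symmetrizedKernel v N) := by
  unfold symmetrizedKernel
  fun_prop

theorem lintegral_sq_symmetrizedKernel {v N : V → ℂ} (hv : Measurable v) (hN : Measurable N)
    (heven : ∀ᵐ ξ, ‖v (-ξ)‖ = ‖v ξ‖) :
    ∫⁻ p, symmetrizedKernel v N p ^ 2 ∂(volume.prod volume) =
      ∫⁻ ξ, ‖N ξ‖ₑ ^ 2 * ∫⁻ η, ‖v (ξ - η)‖ₑ * ‖v η‖ₑ := by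
  have hsq (p : V × V) : symmetrizedKernel v N p ^ 2 =
      ‖v p.1‖ₑ * ‖v p.2‖ₑ * ‖N (p.2 - p.1)‖ₑ ^ 2 := by
    simp only [symmetrizedKernel, mul_pow, ← ENNReal.rpow_mul_natCast]
    norm_num
  calc _ = ∫⁻ a, ∫⁻ b, ‖v a‖ₑ * ‖v b‖ₑ * ‖N (b - a)‖ₑ ^ 2 := by
        simp_rw [hsq]
        exact lintegral_prod _ (by fun_prop)
    _ = ∫⁻ a, ∫⁻ ζ, ‖v a‖ₑ * ‖v (ζ + a)‖ₑ * ‖N ζ‖ₑ ^ 2 := by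
        refine lintegral_congr fun a ↦ ?_
        rw [← lintegral_add_right_eq_self _ a]
        simp
    _ = ∫⁻ ζ, ∫⁻ a, ‖v a‖ₑ * ‖v (ζ + a)‖ₑ * ‖N ζ‖ₑ ^ 2 :=
        lintegral_lintegral_swap (by fun_prop)
    _ = _ := by
        refine lintegral_congr fun ζ ↦ ?_
        rw [lintegral_mul_const _ (by fun_prop), mul_comm]
        congr 1
        rw [← (Measure.measurePreserving_neg (volume : Measure V)).lintegral_comp (by fun_prop)]
        refine lintegral_congr_ae ?_
        filter_upwards [heven] with η hη
        have : ‖v (-η)‖ₑ = ‖v η‖ₑ := by simp [enorm_eq_iff_norm_eq, hη]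
        rw [this, mul_comm, sub_eq_add_neg]

theorem lintegral_mul_autocorrelation {v N : V → ℂ} (hv : Measurable v) (hvi : Integrable v)
    (hN : Measurable N) {C : ℝ} (hNC : ∀ ξ, ‖N ξ‖ ≤ C) :
    ∫⁻ ξ, ‖N ξ‖ₑ ^ 2 * ∫⁻ η, ‖v (ξ - η)‖ₑ * ‖v η‖ₑ =
      ENNReal.ofReal (∫ ξ, ‖N ξ‖ ^ 2 * ∫ η, ‖v (ξ - η)‖ * ‖v η‖) := by
  set G : V → ℝ≥0∞ := fun ξ ↦ ∫⁻ η, ‖v (ξ - η)‖ₑ * ‖v η‖ₑ with hG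
  have hGm : Measurable G := Measurable.lintegral_prod_right' (ν := volume)
    (f := fun q : V × V ↦ ‖v (q.1 - q.2)‖ₑ * ‖v q.2‖ₑ) (by fun_prop)
  have hGint : ∫⁻ ξ, G ξ ≠ ∞ := by
    have : ∫⁻ ξ, G ξ = (∫⁻ ξ, ‖v ξ‖ₑ) * ∫⁻ η, ‖v η‖ₑ := by
      rw [hG, lintegral_lintegral_swap (by fun_prop), ← lintegral_const_mul _ (by fun_prop)]
      refine lintegral_congr fun η ↦ ?_
      rw [lintegral_mul_const _ (by fun_prop), lintegral_sub_right_eq_self (fun ξ ↦ ‖v ξ‖ₑ)]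
    rw [this]
    exact ENNReal.mul_ne_top hvi.2.ne hvi.2.ne
  have hγ (ξ : V) : ∫ η, ‖v (ξ - η)‖ * ‖v η‖ = (G ξ).toReal := by
    rw [integral_eq_lintegral_of_nonneg_ae (.of_forall fun η ↦ by positivity)
      (Measurable.aestronglyMeasurable (by fun_prop))]
    simp [hG, ENNReal.ofReal_mul]
  have hae : ∀ᵐ ξ, ‖N ξ‖ₑ ^ 2 * G ξ = ENNReal.ofReal (‖N ξ‖ ^ 2 * (G ξ).toReal) := by
    filter_upwards [ae_lt_top hGm hGint] with ξ hξ
    rw [ENNReal.ofReal_mul (by positivity), ENNReal.ofReal_toReal hξ.ne,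
      ENNReal.ofReal_pow (norm_nonneg _), ofReal_norm]
  simp_rw [hγ]
  rw [lintegral_congr_ae hae, ofReal_integral_eq_lintegral_ofReal _
    (.of_forall fun ξ ↦ by positivity)]
  refine (integrable_toReal_of_lintegral_ne_top hGm.aemeasurable hGint).bdd_mul (c := C ^ 2)
    (Measurable.aestronglyMeasurable (by fun_prop)) (.of_forall fun ξ ↦ ?_)
  rw [norm_pow, norm_norm]
  gcongr
  exact hNC ξ

theorem hilbertSchmidtNorm_symmetrizedKernel {v N : V → ℂ} (hv : Measurable v)
    (hvi : Integrable v) (hN : Measurable N) {C : ℝ} (hNC : ∀ ξ, ‖N ξ‖ ≤ C)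
    (heven : ∀ᵐ ξ, ‖v (-ξ)‖ = ‖v ξ‖) :
    hilbertSchmidtNorm volume (symmetrizedKernel v N) =
      ENNReal.ofReal √(∫ ξ, ‖N ξ‖ ^ 2 * ∫ η, ‖v (ξ - η)‖ * ‖v η‖) := by
  rw [hilbertSchmidtNorm, lintegral_sq_symmetrizedKernel hv hN heven,
    lintegral_mul_autocorrelation hv hvi hN hNC, Real.sqrt_eq_rpow,
    ENNReal.ofReal_rpow_of_nonneg _ (by norm_num)]
  exact integral_nonneg fun ξ ↦ mul_nonneg (by positivity) (integral_nonneg fun η ↦ by positivity)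

theorem lintegral_cyclic_symmetrizedKernel_le {n : ℕ} [NeZero n] (hn : 2 ≤ n) {v : V → ℂ}
    (hv : Measurable v) {N : Fin n → V → ℂ} (hN : ∀ j, Measurable (N j)) :
    ∫⁻ ξ : Fin n → V, ∏ j, symmetrizedKernel v (N j) (ξ j, ξ (j + 1)) ≤
      ∏ j, hilbertSchmidtNorm volume (symmetrizedKernel v (N j)) := by
  obtain ⟨m, rfl⟩ := Nat.exists_eq_add_of_le' hn
  have := lintegral_chain_le (volume : Measure V) m
    (fun i ↦ measurable_symmetrizedKernel hv (hN i.castSucc))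
    (measurable_symmetrizedKernel hv (hN (Fin.last _)))
  simp only [Fin.prod_univ_castSucc (n := m + 1), Fin.coeSucc_eq_succ, Fin.last_add_one]
  exact this

theorem norm_integral_cyclic_le {n : ℕ} [NeZero n] (hn : 2 ≤ n) {v : V → ℂ} (hv : Measurable v)
    (hvi : Integrable v) (heven : ∀ᵐ ξ, ‖v (-ξ)‖ = ‖v ξ‖)
    (μ : Fin n → Measure V) [∀ j, IsFiniteMeasure (μ j)]
    {f : Fin n → V → ℝ} (hfm : ∀ j, Measurable (f j)) (hf : ∀ j x, |f j x| = 1) :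
    ‖∫ x : Fin n → V, (∏ j, ∫ ξ, Complex.exp (Complex.I * ((⟪x (j + 1) - x j, ξ⟫ : ℝ) : ℂ)) * v ξ) *
        ∏ j, (f j (x j) : ℂ) ∂Measure.pi μ‖ ≤
      ∏ j, √(∫ ξ, ‖signedFourier (μ j) (f j) ξ‖ ^ 2 * ∫ η, ‖v (ξ - η)‖ * ‖v η‖) := by
  rw [integral_cyclic_eq hv hvi μ hfm hf,
    ← ENNReal.ofReal_le_ofReal_iff (Finset.prod_nonneg fun j _ ↦ Real.sqrt_nonneg _), ofReal_norm,
    ENNReal.ofReal_prod_of_nonneg fun j _ ↦ Real.sqrt_nonneg _]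
  have hN (j) := measurable_signedFourier (μ j) (hfm j)
  calc _ ≤ ∫⁻ ξ : Fin n → V, ∏ j, symmetrizedKernel v
        (signedFourier (μ (j + 1)) (f (j + 1))) (ξ j, ξ (j + 1)) := by
        refine (enorm_integral_le_lintegral_enorm _).trans_eq (lintegral_congr fun ξ ↦ ?_)
        rw [prod_symmetrizedKernel v (fun j ↦ signedFourier (μ (j + 1)) (f (j + 1)))]
        rw [← ofReal_norm, norm_prod, ENNReal.ofReal_prod_of_nonneg fun j _ ↦ norm_nonneg _]
        simp
    _ ≤ ∏ j, hilbertSchmidtNorm volume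
        (symmetrizedKernel v (signedFourier (μ (j + 1)) (f (j + 1)))) :=
        lintegral_cyclic_symmetrizedKernel_le hn hv fun j ↦ hN (j + 1)
    _ = ∏ j, hilbertSchmidtNorm volume (symmetrizedKernel v (signedFourier (μ j) (f j))) :=
        Equiv.prod_comp (Equiv.addRight (1 : Fin n)) fun j ↦
          hilbertSchmidtNorm volume (symmetrizedKernel v (signedFourier (μ j) (f j)))
    _ = _ := Finset.prod_congr rfl fun j _ ↦
        hilbertSchmidtNorm_symmetrizedKernel hv hvi (hN j)
          (norm_signedFourier_le (μ j) (hf j)) heven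

end CyclicFourier

/-- Item 1 of Theorem 6.1: the norm `‖ν‖_{γ,2} = (∫ |ν̂(ξ)|² γ(ξ) dξ)^{1/2}` with
`γ = |û| ∗ |û|` is a proper norm with respect to the translation-invariant kernel
`u(x,y) = u(y−x)`: for every `n ≥ 2` and finite signed measures `ν j = f j • μ j`
(with `|f j| = 1`, so `|ν j| = μ j`), and the cyclic convention `z (n+1) = z 1`,
`|∫⋯∫ ∏ u(z_{j+1} − z_j) ∏ dν_j(z_j)| ≤ ∏_j ((2π)^{−d} ∫ |ν̂_j|² γ)^{1/2}`. -/
theorem stmt_1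
    (d : ℕ) (u : EuclideanSpace ℝ (Fin d) → ℝ) (uhat : EuclideanSpace ℝ (Fin d) → ℂ)
    (hu_int : Integrable u volume) (huhat_int : Integrable uhat volume)
    (h_inv : ∀ z, (u z : ℂ) =
      (((2 * Real.pi) ^ (-(d : ℤ)) : ℝ) : ℂ) *
        ∫ ξ, Complex.exp (Complex.I * ((⟪z, ξ⟫ : ℝ) : ℂ)) * uhat ξ)
    (γ : EuclideanSpace ℝ (Fin d) → ℝ)
    (hγ : ∀ ξ, γ ξ = ∫ η, ‖uhat (ξ - η)‖ * ‖uhat η‖)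
    (n : ℕ) (hn : 2 ≤ n) [NeZero n]
    (μ : Fin n → Measure (EuclideanSpace ℝ (Fin d)))
    [∀ j, IsFiniteMeasure (μ j)]
    (f : Fin n → EuclideanSpace ℝ (Fin d) → ℝ)
    (hf_meas : ∀ j, Measurable (f j)) (hf : ∀ j x, |f j x| = 1)
    (νhat : Fin n → EuclideanSpace ℝ (Fin d) → ℂ)
    (hνhat : ∀ j ξ, νhat j ξ =
      ∫ z, Complex.exp (-(Complex.I * ((⟪ξ, z⟫ : ℝ) : ℂ))) * (f j z : ℂ) ∂μ j) :
    |∫ x : Fin n → EuclideanSpace ℝ (Fin d),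
        (∏ j, u (x (j + 1) - x j)) * ∏ j, f j (x j) ∂Measure.pi μ|
      ≤ ∏ j, Real.sqrt ((2 * Real.pi) ^ (-(d : ℤ)) * ∫ ξ, ‖νhat j ξ‖ ^ 2 * γ ξ) := by
  let v := huhat_int.1.mk uhat
  have hv : Measurable v := huhat_int.1.stronglyMeasurable_mk.measurable
  have hvu : uhat =ᵐ[volume] v := huhat_int.1.ae_eq_mk
  have hvi : Integrable v := huhat_int.congr hvu
  set c : ℝ := (2 * Real.pi) ^ (-(d : ℤ)) with hc
  have hc0 : 0 < c := by positivity
  have hc1 : c ≤ 1 := by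
    rw [hc, zpow_neg, zpow_natCast]
    exact inv_le_one_of_one_le₀ (one_le_pow₀ (by linarith [Real.two_le_pi]))
  have hinv (z) : (u z : ℂ) =
      (c : ℂ) * ∫ ξ, Complex.exp (Complex.I * ((⟪z, ξ⟫ : ℝ) : ℂ)) * v ξ := by
    rw [h_inv z]
    congr 1
    refine integral_congr_ae ?_
    filter_upwards [hvu] with ξ hξ
    rw [hξ]
  have hγv (ξ) : γ ξ = ∫ η, ‖v (ξ - η)‖ * ‖v η‖ := by
    rw [hγ ξ]
    refine integral_congr_ae ?_
    filter_upwards [hvu,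
      (quasiMeasurePreserving_sub_left volume ξ).ae_eq_comp hvu] with η h1 h2
    simp only [Function.comp_apply] at h2
    rw [h1, h2]
  have heven : ∀ᵐ ξ, ‖v (-ξ)‖ = ‖v ξ‖ := by
    refine norm_neg_ae_eq_of_integral_real hvi fun z ↦ ?_
    have := congrArg Complex.im (hinv z)
    rw [Complex.ofReal_im, Complex.im_ofReal_mul] at this
    exact (mul_eq_zero.1 this.symm).resolve_left hc0.ne'
  have hN (j) : νhat j = signedFourier (μ j) (f j) := funext (hνhat j)
  calc _ = ‖((∫ x : Fin n → EuclideanSpace ℝ (Fin d),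
        (∏ j, u (x (j + 1) - x j)) * ∏ j, f j (x j) ∂Measure.pi μ : ℝ) : ℂ)‖ := by
        rw [Complex.norm_real, Real.norm_eq_abs]
    _ = c ^ n * ‖∫ x : Fin n → EuclideanSpace ℝ (Fin d), (∏ j, ∫ ξ,
          Complex.exp (Complex.I * ((⟪x (j + 1) - x j, ξ⟫ : ℝ) : ℂ)) * v ξ) *
            ∏ j, (f j (x j) : ℂ) ∂Measure.pi μ‖ := by
        rw [← integral_complex_ofReal]
        push_cast
        simp_rw [hinv, Finset.prod_mul_distrib, mul_assoc]
        rw [integral_const_mul, norm_mul]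
        simp [abs_of_pos hc0]
    _ ≤ c ^ n * ∏ j, √(∫ ξ, ‖νhat j ξ‖ ^ 2 * γ ξ) := by
        simp only [hN, hγv]
        gcongr
        exact norm_integral_cyclic_le hn hv hvi heven μ hf_meas hf
    _ = ∏ j, (c * √(∫ ξ, ‖νhat j ξ‖ ^ 2 * γ ξ)) := by simp [Finset.prod_mul_distrib]
    _ ≤ _ := by
        gcongr with j
        rw [Real.sqrt_mul hc0.le]
        gcongr
        exact Real.le_sqrt_of_sq_le (by nlinarith)
end

section
/- Let (S, m) be a σ-finite measure space and let p : (0,∞) × S × S → [0,∞) be measurable and satisfy the Chapman–Kolmogorov identity ∫ p_s(x,y) p_{s'}(y,z) dm(y) = p_{s+s'}(x,z) for all s, s' > 0 and all x, z ∈ S. Define w(x,y) = ∫_0^∞ p_s(x,y)/√(πs) ds and u(x,z) = ∫_0^∞ p_t(x,z) dt (values in [0,∞]). Then for all x, z ∈ S, ∫ w(x,y) w(y,z) dm(y) = u(x,z). -/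
open MeasureTheory ENNReal
open scoped NNReal

/-- The Beta integral `(1/π) ∫₀ᵗ ds / √(s (t - s)) = 1`. -/
lemma setLIntegral_Ioo_inv_sqrt_mul_inv_sqrt {t : ℝ} (ht : 0 < t) :
    ∫⁻ s in Set.Ioo 0 t, (ENNReal.ofReal (Real.sqrt (Real.pi * s)))⁻¹ *
      (ENNReal.ofReal (Real.sqrt (Real.pi * (t - s))))⁻¹ = 1 := by
  have himage : (fun x : ℝ => t * x) '' Set.Ioo 0 1 = Set.Ioo 0 t := by
    simp [Set.image_mul_left_Ioo ht]
  have hbeta : ProbabilityTheory.beta (1 / 2) (1 / 2) = Real.pi := by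
    rw [ProbabilityTheory.beta, Real.Gamma_one_half_eq, Real.mul_self_sqrt Real.pi_pos.le]
    norm_num
  rw [← himage, lintegral_image_eq_lintegral_abs_deriv_mul measurableSet_Ioo
    (fun x _ => ((hasDerivAt_id' x).const_mul t).hasDerivWithinAt)
    ((mul_right_injective₀ ht.ne').injOn),
    ← ProbabilityTheory.lintegral_betaPDF_eq_one (α := 1 / 2) (β := 1 / 2)
      (by norm_num) (by norm_num), ProbabilityTheory.lintegral_betaPDF]
  refine setLIntegral_congr_fun measurableSet_Ioo fun x ⟨hx0, hx1⟩ => ?_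
  have hx1' : 0 < 1 - x := sub_pos.2 hx1
  have hpi := Real.pi_pos
  have hsub : t - t * x = t * (1 - x) := by ring
  rw [hsub, hbeta, ← ENNReal.ofReal_inv_of_pos (by positivity),
    ← ENNReal.ofReal_inv_of_pos (by positivity), ← ENNReal.ofReal_mul (by positivity),
    ← ENNReal.ofReal_mul (by positivity)]
  congr 1
  rw [show (1 / 2 - 1 : ℝ) = -(1 / 2) by norm_num, Real.rpow_neg hx0.le, Real.rpow_neg hx1'.le,
    ← Real.sqrt_eq_rpow, ← Real.sqrt_eq_rpow, Real.sqrt_mul hpi.le, Real.sqrt_mul hpi.le,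
    Real.sqrt_mul ht.le, Real.sqrt_mul ht.le, mul_one, abs_of_pos ht]
  have hx := Real.sqrt_pos.2 hx0
  have hx' := Real.sqrt_pos.2 hx1'
  have hst := Real.sqrt_pos.2 ht
  have hsp := Real.sqrt_pos.2 hpi
  field_simp
  rw [Real.sq_sqrt ht.le, Real.sq_sqrt hpi.le, mul_comm]

/-- The density `1 / √(πs)` convolved with itself is the indicator of the half-line. -/
lemma lintegral_lintegral_inv_sqrt_mul_comp_add {f : ℝ → ℝ≥0∞} (hf : Measurable f) :
    ∫⁻ s in Set.Ioi (0 : ℝ), ∫⁻ r in Set.Ioi (0 : ℝ),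
      (ENNReal.ofReal (Real.sqrt (Real.pi * s)))⁻¹ *
        (ENNReal.ofReal (Real.sqrt (Real.pi * r)))⁻¹ * f (s + r) =
      ∫⁻ t in Set.Ioi (0 : ℝ), f t := by
  set c : ℝ → ℝ≥0∞ := fun s => (ENNReal.ofReal (Real.sqrt (Real.pi * s)))⁻¹
  have hcm : Measurable c := by fun_prop
  have hshift (s : ℝ) : ∫⁻ r in Set.Ioi (0 : ℝ), c s * c r * f (s + r) =
      ∫⁻ t, (Set.Ioi 0).indicator (fun r => c s * c r * f (s + r)) (t - s) := by
    rw [lintegral_sub_right_eq_self (fun r => (Set.Ioi (0 : ℝ)).indicator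
      (fun r => c s * c r * f (s + r)) r) s, lintegral_indicator measurableSet_Ioi]
  have hmeas : Measurable fun q : ℝ × ℝ =>
      (Set.Ioi (0 : ℝ)).indicator (fun r => c q.1 * c r * f (q.1 + r)) (q.2 - q.1) := by
    have heq : (fun q : ℝ × ℝ =>
        (Set.Ioi (0 : ℝ)).indicator (fun r => c q.1 * c r * f (q.1 + r)) (q.2 - q.1)) =
        {q : ℝ × ℝ | q.1 < q.2}.indicator (fun q => c q.1 * c (q.2 - q.1) * f q.2) := by
      ext q
      simp [Set.indicator_apply]
    rw [heq]
    exact Measurable.indicator (by fun_prop) (measurableSet_lt measurable_fst measurable_snd)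
  calc ∫⁻ s in Set.Ioi (0 : ℝ), ∫⁻ r in Set.Ioi (0 : ℝ), c s * c r * f (s + r)
      = ∫⁻ t, ∫⁻ s in Set.Ioi (0 : ℝ),
          (Set.Ioi 0).indicator (fun r => c s * c r * f (s + r)) (t - s) := by
        simp_rw [hshift]
        exact lintegral_lintegral_swap hmeas.aemeasurable
    _ = ∫⁻ t, (Set.Ioi 0).indicator f t := by
        refine lintegral_congr fun t => ?_
        have hinner : ∫⁻ s in Set.Ioi (0 : ℝ),
            (Set.Ioi 0).indicator (fun r => c s * c r * f (s + r)) (t - s) =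
            ∫⁻ s in Set.Ioo 0 t, c s * c (t - s) * f t := by
          rw [← lintegral_indicator measurableSet_Ioi, ← lintegral_indicator measurableSet_Ioo]
          refine lintegral_congr fun s => ?_
          by_cases h0 : 0 < s <;> by_cases h1 : s < t <;> simp [h0, h1]
        rw [hinner, lintegral_mul_const _ (by fun_prop)]
        by_cases ht : 0 < t
        · rw [setLIntegral_Ioo_inv_sqrt_mul_inv_sqrt ht]
          simp [ht]
        · simp [ht]
    _ = _ := lintegral_indicator measurableSet_Ioi f

lemma measurable_coe_nnreal_comp₃ {α S : Type*} [MeasurableSpace α] [MeasurableSpace S]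
    {p : ℝ → S → S → ℝ≥0} (hp : Measurable (fun q : ℝ × S × S => p q.1 q.2.1 q.2.2))
    {a : α → ℝ} {b d : α → S} (ha : Measurable a) (hb : Measurable b) (hd : Measurable d) :
    Measurable fun i => (p (a i) (b i) (d i) : ℝ≥0∞) :=
  (hp.comp (ha.prodMk (hb.prodMk hd))).coe_nnreal_ennreal

/-- Identity (n.lj3): if `p` satisfies the Chapman–Kolmogorov identity with respect to a
σ-finite measure `m`, and `w(x,y) = ∫₀^∞ p_s(x,y)/√(πs) ds`, `u(x,z) = ∫₀^∞ p_t(x,z) dt`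
(values in `[0,∞]`), then `∫ w(x,y) w(y,z) dm(y) = u(x,z)` for all `x, z`. -/
theorem stmt_4 {S : Type*} [MeasurableSpace S] (m : Measure S) [SigmaFinite m]
    (p : ℝ → S → S → ℝ≥0)
    (hp_meas : Measurable (fun q : ℝ × S × S => p q.1 q.2.1 q.2.2))
    (hCK : ∀ s s' : ℝ, 0 < s → 0 < s' → ∀ x z : S,
      ∫⁻ y, (p s x y : ℝ≥0∞) * (p s' y z : ℝ≥0∞) ∂m = (p (s + s') x z : ℝ≥0∞))
    (w u : S → S → ℝ≥0∞)
    (hw : ∀ x y, w x y = ∫⁻ s in Set.Ioi (0 : ℝ),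
        (p s x y : ℝ≥0∞) / ENNReal.ofReal (Real.sqrt (Real.pi * s)))
    (hu : ∀ x z, u x z = ∫⁻ t in Set.Ioi (0 : ℝ), (p t x z : ℝ≥0∞)) :
    ∀ x z : S, ∫⁻ y, w x y * w y z ∂m = u x z := by
  intro x z
  set c : ℝ → ℝ≥0∞ := fun s => (ENNReal.ofReal (Real.sqrt (Real.pi * s)))⁻¹
  have hcm : Measurable c := by fun_prop
  have hleft : Measurable fun q : S × ℝ => (p q.2 x q.1 : ℝ≥0∞) * c q.2 :=
    (measurable_coe_nnreal_comp₃ hp_meas measurable_snd measurable_const measurable_fst).mul (hcm.comp measurable_snd)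
  have hright : Measurable fun q : S × ℝ => (p q.2 q.1 z : ℝ≥0∞) * c q.2 :=
    (measurable_coe_nnreal_comp₃ hp_meas measurable_snd measurable_fst measurable_const).mul (hcm.comp measurable_snd)
  have hright_int : Measurable fun y => ∫⁻ r in Set.Ioi (0 : ℝ), (p r y z : ℝ≥0∞) * c r :=
    hright.lintegral_prod_right'
  calc ∫⁻ y, w x y * w y z ∂m
      = ∫⁻ y, (∫⁻ s in Set.Ioi (0 : ℝ), (p s x y : ℝ≥0∞) * c s *
          (∫⁻ r in Set.Ioi (0 : ℝ), (p r y z : ℝ≥0∞) * c r)) ∂m := by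
        refine lintegral_congr fun y => ?_
        rw [hw, hw]
        exact (lintegral_mul_const _ (hleft.comp measurable_prodMk_left)).symm
    _ = ∫⁻ s in Set.Ioi (0 : ℝ), ∫⁻ y, (p s x y : ℝ≥0∞) * c s *
          (∫⁻ r in Set.Ioi (0 : ℝ), (p r y z : ℝ≥0∞) * c r) ∂m :=
        lintegral_lintegral_swap
          (hleft.mul (hright_int.comp measurable_fst)).aemeasurable
    _ = ∫⁻ s in Set.Ioi (0 : ℝ), ∫⁻ r in Set.Ioi (0 : ℝ), c s * c r * (p (s + r) x z : ℝ≥0∞) := by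
        refine setLIntegral_congr_fun measurableSet_Ioi fun s hs => ?_
        have hleft_s : Measurable fun y => (p s x y : ℝ≥0∞) * c s :=
          hleft.comp measurable_prodMk_right
        calc ∫⁻ y, (p s x y : ℝ≥0∞) * c s *
              (∫⁻ r in Set.Ioi (0 : ℝ), (p r y z : ℝ≥0∞) * c r) ∂m
            = ∫⁻ y, (∫⁻ r in Set.Ioi (0 : ℝ),
                (p s x y : ℝ≥0∞) * c s * ((p r y z : ℝ≥0∞) * c r)) ∂m := by
              exact lintegral_congr fun y =>
                (lintegral_const_mul _ (hright.comp measurable_prodMk_left)).symm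
          _ = ∫⁻ r in Set.Ioi (0 : ℝ), ∫⁻ y,
                (p s x y : ℝ≥0∞) * c s * ((p r y z : ℝ≥0∞) * c r) ∂m :=
              lintegral_lintegral_swap ((hleft_s.comp measurable_fst).mul hright).aemeasurable
          _ = _ := by
              refine setLIntegral_congr_fun measurableSet_Ioi fun r hr => ?_
              have hprod : Measurable fun y => (p s x y : ℝ≥0∞) * (p r y z : ℝ≥0∞) :=
                (measurable_coe_nnreal_comp₃ hp_meas measurable_const measurable_const
                  measurable_id).mul (measurable_coe_nnreal_comp₃ hp_meas measurable_const
                    measurable_id measurable_const)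
              rw [← hCK s r hs hr, ← lintegral_const_mul _ hprod]
              exact lintegral_congr fun y => by ring
    _ = u x z := by
        rw [hu]
        exact lintegral_lintegral_inv_sqrt_mul_comp_add
          (measurable_coe_nnreal_comp₃ hp_meas measurable_id measurable_const measurable_const)
end

section
/- Let (S, m) be a σ-finite measure space and let p : (0,∞) × S × S → [0,∞) be measurable and satisfy the Chapman–Kolmogorov identity ∫ p_s(x,y) p_{s'}(y,z) dm(y) = p_{s+s'}(x,z) for all s, s' > 0 and all x, z ∈ S. Define u(x,y) = ∫_0^∞ p_t(x,y) dt, Θ_l(x,y) = ∫_0^∞ ∫ p_{s/2}(x,v) p_{s/2}(y,v) dm(v) ds, Θ_r(x,y) = ∫_0^∞ ∫ p_{s/2}(v,x) p_{s/2}(v,y) dm(v) ds, and Φ(x,y) = Θ_l(x,y) Θ_r(x,y). Then there is a universal constant C < ∞ such that for every n ≥ 2 and all finite signed Borel measures ν_1, …, ν_n on S with ∫∫ Φ d|ν_j| d|ν_j| < ∞, one has, with x_{n+1} = x_1, |∫⋯∫ ∏_{j=1}^n u(x_j, x_{j+1}) ∏_{j=1}^n dν_j(x_j)| ≤ C^n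 ∏_{j=1}^n (∫∫ Φ(x,y) dν_j(x) dν_j(y))^{1/2}; in particular the double integrals on the right-hand side are nonnegative. -/
open MeasureTheory ENNReal
open scoped NNReal

/-- The `L²` seminorm of an `ℝ≥0∞`-valued function. -/
noncomputable def lintegralL2 {α : Type*} [MeasurableSpace α] (μ : Measure α)
    (f : α → ℝ≥0∞) : ℝ≥0∞ :=
  (∫⁻ a, f a ^ (2 : ℝ) ∂μ) ^ (1 / 2 : ℝ)

theorem lintegral_mul_le_lintegralL2 {α : Type*} [MeasurableSpace α] (μ : Measure α)
    {f g : α → ℝ≥0∞} (hf : Measurable f) (hg : Measurable g) :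
    ∫⁻ a, f a * g a ∂μ ≤ lintegralL2 μ f * lintegralL2 μ g :=
  ENNReal.lintegral_mul_le_Lp_mul_Lq μ .two_two hf.aemeasurable hg.aemeasurable

theorem lintegralL2_rpow_two {α : Type*} [MeasurableSpace α] (μ : Measure α) (f : α → ℝ≥0∞) :
    lintegralL2 μ f ^ (2 : ℝ) = ∫⁻ a, f a ^ (2 : ℝ) ∂μ := by
  rw [lintegralL2, ← ENNReal.rpow_mul]
  norm_num

theorem lintegralL2_comp_swap {α : Type*} [MeasurableSpace α] (μ : Measure α) [SFinite μ]
    (f : α × α → ℝ≥0∞) :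
    lintegralL2 (μ.prod μ) (fun z => f z.swap) = lintegralL2 (μ.prod μ) f := by
  unfold lintegralL2
  rw [lintegral_prod_swap (fun z => f z ^ (2 : ℝ))]

/-- The Hilbert–Schmidt norm is submultiplicative under composition of kernels. -/
theorem lintegralL2_comp_le {α : Type*} [MeasurableSpace α] (μ : Measure α) [SFinite μ]
    {b c : α × α → ℝ≥0∞} (hb : Measurable b) (hc : Measurable c) :
    lintegralL2 (μ.prod μ) (fun z => ∫⁻ y, b (z.1, y) * c (y, z.2) ∂μ)
      ≤ lintegralL2 (μ.prod μ) b * lintegralL2 (μ.prod μ) c := by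
  have hc' : Measurable fun z : α × α => c z.swap := hc.comp measurable_swap
  have hmeas {d : α × α → ℝ≥0∞} (hd : Measurable d) :
      Measurable fun x => ∫⁻ y, d (x, y) ^ (2 : ℝ) ∂μ := (hd.pow_const _).lintegral_prod_right'
  rw [← ENNReal.rpow_le_rpow_iff (z := 2) (by norm_num), lintegralL2_rpow_two,
    ENNReal.mul_rpow_of_nonneg _ _ (by norm_num), lintegralL2_rpow_two,
    ← lintegralL2_comp_swap μ c, lintegralL2_rpow_two,
    lintegral_prod _ (hb.pow_const _).aemeasurable,
    lintegral_prod _ (hc'.pow_const _).aemeasurable,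
    ← lintegral_prod_mul (hmeas hb).aemeasurable (hmeas hc').aemeasurable]
  refine lintegral_mono fun z => ?_
  have h := lintegral_mul_le_lintegralL2 μ (f := fun y => b (z.1, y)) (g := fun y => c (y, z.2))
    (by fun_prop) (by fun_prop)
  have h2 := ENNReal.rpow_le_rpow h (z := 2) (by norm_num)
  rwa [ENNReal.mul_rpow_of_nonneg _ _ (by norm_num), lintegralL2_rpow_two,
    lintegralL2_rpow_two] at h2

theorem lintegral_pi_fin_succ {α : Type*} [MeasurableSpace α] {n : ℕ}
    (μ : Fin (n + 1) → Measure α) [∀ i, SigmaFinite (μ i)] {F : (Fin (n + 1) → α) → ℝ≥0∞}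
    (hF : Measurable F) :
    ∫⁻ x, F x ∂Measure.pi μ =
      ∫⁻ y, ∫⁻ z, F (Fin.cons y z) ∂Measure.pi (fun i => μ i.succ) ∂μ 0 := by
  have h := (measurePreserving_piFinSuccAbove μ 0).symm
  have hm := hF.comp h.measurable
  rw [← h.lintegral_comp hF]
  simp only [Function.comp_def, MeasurableEquiv.piFinSuccAbove_symm_apply,
    Fin.insertNthEquiv_zero, Fin.zero_succAbove] at hm ⊢
  exact lintegral_prod _ hm.aemeasurable

theorem lintegral_pi_fin_prod_eq_prod {α : Type*} [MeasurableSpace α] {n : ℕ}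
    (μ : Fin n → Measure α) [∀ i, SigmaFinite (μ i)] {F : Fin n → α → ℝ≥0∞}
    (hF : ∀ i, Measurable (F i)) :
    ∫⁻ x, ∏ i, F i (x i) ∂Measure.pi μ = ∏ i, ∫⁻ x, F i x ∂μ i := by
  induction n with
  | zero => simp
  | succ n ih =>
    have hm : Measurable fun z : Fin n → α => ∏ i : Fin n, F i.succ (z i) :=
      Finset.measurable_fun_prod _ fun i _ => (hF _).comp (measurable_pi_apply i)
    have hm' : Measurable fun x : Fin (n + 1) → α => ∏ i, F i (x i) :=
      Finset.measurable_fun_prod _ fun i _ => (hF i).comp (measurable_pi_apply i)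
    rw [lintegral_pi_fin_succ μ hm']
    simp only [Fin.prod_univ_succ, Fin.cons_zero, Fin.cons_succ]
    simp_rw [lintegral_const_mul _ hm]
    rw [lintegral_mul_const _ (hF 0), ih (fun i => μ i.succ) (fun i => hF i.succ)]

theorem measurable_kernel_path {α : Type*} [MeasurableSpace α] {n : ℕ}
    {b : Fin n → α × α → ℝ≥0∞} (hb : ∀ i, Measurable (b i)) :
    Measurable fun x : Fin (n + 1) → α => ∏ i : Fin n, b i (x i.castSucc, x i.succ) :=
  Finset.measurable_fun_prod _ fun i _ =>
    (hb i).comp ((measurable_pi_apply _).prodMk (measurable_pi_apply _))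

/-- A cyclic integral of at least two kernels is bounded by the product of their
Hilbert–Schmidt norms. -/
theorem lintegral_closed_path_le {α : Type*} [MeasurableSpace α] (μ : Measure α)
    [SigmaFinite μ] (n : ℕ) {c : α × α → ℝ≥0∞} (hc : Measurable c)
    {b : Fin (n + 1) → α × α → ℝ≥0∞} (hb : ∀ i, Measurable (b i)) :
    ∫⁻ x : Fin (n + 2) → α, (∏ i : Fin (n + 1), b i (x i.castSucc, x i.succ)) *
        c (x (Fin.last _), x 0) ∂Measure.pi (fun _ => μ)
      ≤ (∏ i, lintegralL2 (μ.prod μ) (b i)) * lintegralL2 (μ.prod μ) c := by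
  induction n generalizing c with
  | zero =>
    have h := measurePreserving_piFinTwo (fun _ : Fin 2 => μ)
    have hm : Measurable fun z : α × α => b 0 z * c z.swap :=
      (hb 0).mul (hc.comp measurable_swap)
    have h2 := h.lintegral_comp hm
    simp only [Fin.prod_univ_succ (n := 0), Finset.univ_eq_empty, Finset.prod_empty, mul_one]
    rw [← lintegralL2_comp_swap μ c]
    exact h2.trans_le (lintegral_mul_le_lintegralL2 _ (hb 0) (hc.comp measurable_swap))
  | succ n ih =>
    have hcomp : Measurable fun z : α × α => ∫⁻ y, c (z.1, y) * b 0 (y, z.2) ∂μ := by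
      have : Measurable fun q : (α × α) × α => c (q.1.1, q.2) * b 0 (q.2, q.1.2) := by
        have := hb 0
        fun_prop
      exact this.lintegral_prod_right'
    have hpath := measurable_kernel_path (fun i : Fin (n + 1) => hb i.succ)
    have hF : Measurable fun x : Fin (n + 3) → α =>
        (∏ i : Fin (n + 2), b i (x i.castSucc, x i.succ)) * c (x (Fin.last _), x 0) :=
      (measurable_kernel_path hb).mul
        (hc.comp ((measurable_pi_apply _).prodMk (measurable_pi_apply _)))
    have hG : Measurable fun q : α × (Fin (n + 2) → α) =>
        (∏ i : Fin (n + 1), b i.succ (q.2 i.castSucc, q.2 i.succ)) *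
          (c (q.2 (Fin.last _), q.1) * b 0 (q.1, q.2 0)) := by
      refine (hpath.comp measurable_snd).mul ?_
      have := hb 0
      fun_prop
    calc
      _ = ∫⁻ y, ∫⁻ x : Fin (n + 2) → α,
          (∏ i : Fin (n + 1), b i.succ (x i.castSucc, x i.succ)) *
            (c (x (Fin.last _), y) * b 0 (y, x 0)) ∂Measure.pi (fun _ => μ) ∂μ := by
        rw [lintegral_pi_fin_succ _ hF]
        refine lintegral_congr fun y => lintegral_congr fun x => ?_
        rw [Fin.prod_univ_succ]
        simp only [← Fin.succ_last, Fin.cons_succ, Fin.cons_zero, Fin.castSucc_zero,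
          ← Fin.succ_castSucc]
        ring
      _ = ∫⁻ x : Fin (n + 2) → α,
          (∏ i : Fin (n + 1), b i.succ (x i.castSucc, x i.succ)) *
            (∫⁻ y, c (x (Fin.last _), y) * b 0 (y, x 0) ∂μ) ∂Measure.pi (fun _ => μ) := by
        rw [lintegral_lintegral_swap hG.aemeasurable]
        refine lintegral_congr fun x => lintegral_const_mul _ ?_
        have := hb 0
        fun_prop
      _ ≤ _ := ih hcomp (fun i => hb i.succ)
      _ ≤ (∏ i : Fin (n + 1), lintegralL2 (μ.prod μ) (b i.succ)) *
          (lintegralL2 (μ.prod μ) c * lintegralL2 (μ.prod μ) (b 0)) := by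
        gcongr
        exact lintegralL2_comp_le μ hc (hb 0)
      _ = _ := by
        rw [Fin.prod_univ_succ (n := n + 1)]
        ring

theorem lintegral_cyclic_prod_le {α : Type*} [MeasurableSpace α] (μ : Measure α)
    [SigmaFinite μ] (n : ℕ) {b : Fin (n + 2) → α × α → ℝ≥0∞} (hb : ∀ i, Measurable (b i)) :
    ∫⁻ x : Fin (n + 2) → α, ∏ i, b i (x i, x (i + 1)) ∂Measure.pi (fun _ => μ)
      ≤ ∏ i, lintegralL2 (μ.prod μ) (b i) := by
  simpa only [Fin.prod_univ_castSucc (n := n + 1), Fin.coeSucc_eq_succ, Fin.last_add_one] using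
    lintegral_closed_path_le μ n (hb (Fin.last _)) (fun i => hb i.castSucc)

/-- Fubini's theorem for a nonnegative integrand multiplied by a sign. -/
theorem integral_toReal_lintegral_mul_sign {X Y : Type*} [MeasurableSpace X] [MeasurableSpace Y]
    (μ : Measure X) (ν : Measure Y) [SFinite μ] [SFinite ν] {F : X → Y → ℝ≥0}
    (hF : Measurable (Function.uncurry F)) {ψ : X → ℝ} (hψ : Measurable ψ)
    (hψ1 : ∀ x, |ψ x| = 1) (hfin : ∫⁻ y, ∫⁻ x, (F x y : ℝ≥0∞) ∂μ ∂ν < ⊤) :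
    ∫ x, (∫⁻ y, (F x y : ℝ≥0∞) ∂ν).toReal * ψ x ∂μ = ∫ y, ∫ x, (F x y : ℝ) * ψ x ∂μ ∂ν := by
  have hint : Integrable (Function.uncurry fun x y => (F x y : ℝ) * ψ x) (μ.prod ν) := by
    refine ⟨(hF.coe_nnreal_real.mul (hψ.comp measurable_fst)).aestronglyMeasurable, ?_⟩
    have hψe : ∀ x, ‖ψ x‖ₑ = 1 := fun x => by
      rw [← ofReal_norm, Real.norm_eq_abs, hψ1, ENNReal.ofReal_one]
    have : ∀ q : X × Y, ‖(Function.uncurry fun x y => (F x y : ℝ) * ψ x) q‖ₑ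
        = (F q.1 q.2 : ℝ≥0∞) := fun q => by
      simp [Function.uncurry, enorm_mul, hψe]
    rw [HasFiniteIntegral, lintegral_congr this]
    exact (lintegral_prod_symm' _ hF.coe_nnreal_ennreal).trans_lt hfin
  rw [← integral_integral_swap hint]
  refine integral_congr_ae (.of_forall fun x => ?_)
  have hx : Measurable fun y => (F x y : ℝ≥0∞) :=
    (hF.comp measurable_prodMk_left).coe_nnreal_ennreal
  have := integral_toReal hx.aemeasurable (.of_forall fun y => ENNReal.coe_lt_top) (μ := ν)
  simp only [ENNReal.coe_toReal] at this
  simp only [integral_mul_const, this]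

theorem prod_fin_add_one {M : Type*} [CommMonoid M] {n : ℕ} [NeZero n] (G : Fin n → M) :
    ∏ j, G (j + 1) = ∏ j, G j :=
  Equiv.prod_comp (Equiv.addRight (1 : Fin n)) G

theorem lintegral_energy_eq {S W : Type*} [MeasurableSpace S] [MeasurableSpace W]
    (μ : Measure S) (ρ : Measure W) [SFinite μ] [SFinite ρ] {k : W → S → ℝ≥0}
    (hk : Measurable (Function.uncurry k)) :
    ∫⁻ q : S × S, ∫⁻ w, (k w q.1 : ℝ≥0∞) * k w q.2 ∂ρ ∂μ.prod μ
      = ∫⁻ w, (∫⁻ x, (k w x : ℝ≥0∞) ∂μ) ^ (2 : ℝ) ∂ρ := by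
  have hm : Measurable fun q : (S × S) × W => (k q.2 q.1.1 : ℝ≥0∞) * k q.2 q.1.2 :=
    (hk.comp (measurable_snd.prodMk (measurable_fst.comp measurable_fst))).coe_nnreal_ennreal.mul
      (hk.comp (measurable_snd.prodMk (measurable_snd.comp measurable_fst))).coe_nnreal_ennreal
  rw [lintegral_lintegral_swap hm.aemeasurable]
  refine lintegral_congr fun w => ?_
  have hw : Measurable fun x => (k w x : ℝ≥0∞) :=
    (hk.comp measurable_prodMk_left).coe_nnreal_ennreal
  rw [lintegral_prod_mul hw.aemeasurable hw.aemeasurable, ENNReal.rpow_two, sq]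

theorem integral_energy_eq {S W : Type*} [MeasurableSpace S] [MeasurableSpace W]
    (μ : Measure S) (ρ : Measure W) [SFinite μ] [SFinite ρ] {k : W → S → ℝ≥0}
    (hk : Measurable (Function.uncurry k)) {f : S → ℝ} (hf : Measurable f)
    (hf1 : ∀ x, |f x| = 1)
    (hfin : ∫⁻ q : S × S, ∫⁻ w, (k w q.1 : ℝ≥0∞) * k w q.2 ∂ρ ∂μ.prod μ < ⊤) :
    ∫ q : S × S, (∫⁻ w, (k w q.1 : ℝ≥0∞) * k w q.2 ∂ρ).toReal * f q.1 * f q.2 ∂μ.prod μ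
      = ∫ w, (∫ x, (k w x : ℝ) * f x ∂μ) ^ 2 ∂ρ := by
  have hm : Measurable (Function.uncurry fun (q : S × S) w => k w q.1 * k w q.2) :=
    (hk.comp (measurable_snd.prodMk (measurable_fst.comp measurable_fst))).mul
      (hk.comp (measurable_snd.prodMk (measurable_snd.comp measurable_fst)))
  have h := integral_toReal_lintegral_mul_sign (μ.prod μ) ρ hm
    (ψ := fun q => f q.1 * f q.2) (by fun_prop) (fun q => by simp [abs_mul, hf1]) (by
      rw [← lintegral_lintegral_swap hm.coe_nnreal_ennreal.aemeasurable]
      simpa only [ENNReal.coe_mul] using hfin)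
  simp only [ENNReal.coe_mul, NNReal.coe_mul, ← mul_assoc] at h
  rw [h]
  refine integral_congr_ae (.of_forall fun w => ?_)
  simp only [sq]
  rw [← integral_prod_mul]
  refine integral_congr_ae (.of_forall fun q => ?_)
  simp only
  ring

theorem enorm_integral_mul_sign_le {S : Type*} [MeasurableSpace S] (μ : Measure S)
    (k : S → ℝ≥0) {f : S → ℝ} (hf1 : ∀ x, |f x| = 1) :
    ‖∫ x, (k x : ℝ) * f x ∂μ‖ₑ ≤ ∫⁻ x, (k x : ℝ≥0∞) ∂μ := by
  refine (enorm_integral_le_lintegral_enorm _).trans_eq (lintegral_congr fun x => ?_)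
  rw [enorm_mul, ← ofReal_norm (f x), Real.norm_eq_abs, hf1]
  simp

theorem lintegralL2_enorm {W : Type*} [MeasurableSpace W] (ρ : Measure W) {A : W → ℝ}
    (hA : Measurable A) (hfin : lintegralL2 ρ (fun w => ‖A w‖ₑ) < ⊤) :
    lintegralL2 ρ (fun w => ‖A w‖ₑ) = ENNReal.ofReal (Real.sqrt (∫ w, A w ^ 2 ∂ρ)) := by
  have h2 : ∫⁻ w, ‖A w‖ₑ ^ (2 : ℝ) ∂ρ = ∫⁻ w, ENNReal.ofReal (A w ^ 2) ∂ρ :=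
    lintegral_congr fun w => by
      rw [ENNReal.rpow_two, ← sq_abs, ENNReal.ofReal_pow (abs_nonneg _), Real.enorm_eq_ofReal_abs]
  have hne : ∫⁻ w, ENNReal.ofReal (A w ^ 2) ∂ρ ≠ ⊤ := by
    rw [← h2, ← lintegralL2_rpow_two]
    exact ENNReal.rpow_ne_top_of_nonneg (by norm_num) hfin.ne
  rw [integral_eq_lintegral_of_nonneg_ae (.of_forall fun w => sq_nonneg _)
    (hA.pow_const 2).aestronglyMeasurable, Real.sqrt_eq_rpow,
    ← ENNReal.ofReal_rpow_of_nonneg ENNReal.toReal_nonneg (by norm_num),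
    ENNReal.ofReal_toReal hne, lintegralL2, h2]

/-- The cyclic integral of a kernel `u = h ∘ g` against signed measures is bounded by the product
of the Hilbert–Schmidt norms of the operators obtained by regrouping the factors at each point. -/
theorem abs_integral_cyclic_prod_le {S W : Type*} [MeasurableSpace S] [MeasurableSpace W]
    (κ : Measure W) [SigmaFinite κ] {g : W → S → ℝ≥0} {h : S → W → ℝ≥0}
    (hg : Measurable (Function.uncurry g)) (hh : Measurable (Function.uncurry h)) (n : ℕ)
    (μ : Fin (n + 2) → Measure S) [∀ j, IsFiniteMeasure (μ j)] {f : Fin (n + 2) → S → ℝ}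
    (hf : ∀ j, Measurable (f j)) (hf1 : ∀ j x, |f j x| = 1)
    (hfin : ∀ j, lintegralL2 (κ.prod κ)
      (fun w => ∫⁻ x, ((g w.1 x * h x w.2 : ℝ≥0) : ℝ≥0∞) ∂μ j) < ⊤) :
    |∫ x : Fin (n + 2) → S, (∏ j, (∫⁻ w, (h (x j) w : ℝ≥0∞) * g w (x (j + 1)) ∂κ).toReal) *
        ∏ j, f j (x j) ∂Measure.pi μ|
      ≤ ∏ j, Real.sqrt (∫ w, (∫ x, ((g w.1 x * h x w.2 : ℝ≥0) : ℝ) * f j x ∂μ j) ^ 2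
          ∂κ.prod κ) := by
  set k : W × W → S → ℝ≥0 := fun w x => g w.1 x * h x w.2
  have hk : Measurable (Function.uncurry k) :=
    (hg.comp ((measurable_fst.comp measurable_fst).prodMk measurable_snd)).mul
      (hh.comp (measurable_snd.prodMk (measurable_snd.comp measurable_fst)))
  have hkw (w : W × W) : Measurable (k w) := hk.comp measurable_prodMk_left
  set A : Fin (n + 2) → W × W → ℝ := fun j w => ∫ x, (k w x : ℝ) * f j x ∂μ j
  set a : Fin (n + 2) → W × W → ℝ≥0∞ := fun j w => ∫⁻ x, (k w x : ℝ≥0∞) ∂μ j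
  have hA (j) : Measurable (A j) := by
    have : StronglyMeasurable fun q : (W × W) × S => (k q.1 q.2 : ℝ) * f j q.2 :=
      (hk.coe_nnreal_real.mul ((hf j).comp measurable_snd)).stronglyMeasurable
    exact this.integral_prod_right'.measurable
  have ha (j) : Measurable (a j) := hk.coe_nnreal_ennreal.lintegral_prod_right'
  have hAa (j w) : ‖A j w‖ₑ ≤ a j w := enorm_integral_mul_sign_le (μ j) (k w) (hf1 j)
  have hAfin (j) : lintegralL2 (κ.prod κ) (fun w => ‖A j w‖ₑ) < ⊤ := by
    refine lt_of_le_of_lt ?_ (hfin j)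
    unfold lintegralL2
    gcongr with w
    exact hAa j w
  let F : (Fin (n + 2) → S) → (Fin (n + 2) → W) → ℝ≥0 :=
    fun x w => ∏ j, k (w j, w (j + 1)) (x (j + 1))
  have hF : Measurable (Function.uncurry F) :=
    Finset.measurable_fun_prod _ fun j _ => hk.comp (by fun_prop :
      Measurable fun q : (Fin (n + 2) → S) × (Fin (n + 2) → W) =>
        ((q.2 j, q.2 (j + 1)), q.1 (j + 1)))
  have hFu (x) : ∫⁻ w, (F x w : ℝ≥0∞) ∂Measure.pi (fun _ => κ)
      = ∏ j, ∫⁻ w, (h (x j) w : ℝ≥0∞) * g w (x (j + 1)) ∂κ := by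
    have hhg (j) : Measurable fun w => (h (x j) w : ℝ≥0∞) * g w (x (j + 1)) :=
      (hh.comp measurable_prodMk_left).coe_nnreal_ennreal.mul
        (hg.comp measurable_prodMk_right).coe_nnreal_ennreal
    rw [← lintegral_pi_fin_prod_eq_prod (fun _ => κ) hhg]
    refine lintegral_congr fun w => ?_
    simp only [F, k, ENNReal.ofNNReal_finsetProd, ENNReal.coe_mul, Finset.prod_mul_distrib]
    rw [mul_comm, prod_fin_add_one fun j => (h (x j) (w j) : ℝ≥0∞)]
  have hFprod (x w) : F x w = ∏ j, k (w (j - 1), w j) (x j) := by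
    rw [← prod_fin_add_one]
    simp [F]
  have hFlint (w) : ∫⁻ x, (F x w : ℝ≥0∞) ∂Measure.pi μ
      = ∏ j, a (j + 1) (w j, w (j + 1)) := by
    simp only [hFprod, ENNReal.ofNNReal_finsetProd]
    rw [lintegral_pi_fin_prod_eq_prod μ fun j => (hkw _).coe_nnreal_ennreal,
      ← prod_fin_add_one]
    simp [a]
  have hFint (w) : ∫ x, (F x w : ℝ) * ∏ j, f j (x j) ∂Measure.pi μ
      = ∏ j, A (j + 1) (w j, w (j + 1)) := by
    simp only [hFprod, NNReal.coe_prod, ← Finset.prod_mul_distrib]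
    rw [integral_fintype_prod_eq_prod (fun j y => (k (w (j - 1), w j) y : ℝ) * f j y),
      ← prod_fin_add_one]
    simp [A]
  have htot : ∫⁻ w, ∫⁻ x, (F x w : ℝ≥0∞) ∂Measure.pi μ ∂Measure.pi (fun _ => κ) < ⊤ := by
    simp only [hFlint]
    refine (lintegral_cyclic_prod_le κ n fun j => ha (j + 1)).trans_lt ?_
    exact ENNReal.prod_lt_top fun j _ => hfin (j + 1)
  have hmain := integral_toReal_lintegral_mul_sign (Measure.pi μ) (Measure.pi fun _ => κ) hF
    (ψ := fun x => ∏ j, f j (x j))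
    (Finset.measurable_fun_prod _ fun j _ => (hf j).comp (measurable_pi_apply j))
    (fun x => by simp [Finset.abs_prod, hf1]) htot
  simp only [hFu, ENNReal.toReal_prod, hFint] at hmain
  rw [hmain]
  have hnn : 0 ≤ ∏ j, Real.sqrt (∫ w, A j w ^ 2 ∂κ.prod κ) :=
    Finset.prod_nonneg fun j _ => Real.sqrt_nonneg _
  rw [← ENNReal.ofReal_le_ofReal_iff hnn, ← Real.enorm_eq_ofReal_abs,
    ENNReal.ofReal_prod_of_nonneg fun j _ => Real.sqrt_nonneg _]
  calc
    _ ≤ ∫⁻ w : Fin (n + 2) → W, ‖∏ j, A (j + 1) (w j, w (j + 1))‖ₑ ∂Measure.pi fun _ => κ :=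
      enorm_integral_le_lintegral_enorm _
    _ = ∫⁻ w : Fin (n + 2) → W, ∏ j, ‖A (j + 1) (w j, w (j + 1))‖ₑ ∂Measure.pi fun _ => κ := by
      refine lintegral_congr fun w => ?_
      simp only [Real.enorm_eq_ofReal_abs, Finset.abs_prod]
      exact ENNReal.ofReal_prod_of_nonneg fun j _ => abs_nonneg _
    _ ≤ ∏ j, lintegralL2 (κ.prod κ) (fun z => ‖A (j + 1) z‖ₑ) :=
      lintegral_cyclic_prod_le κ n fun j => (hA (j + 1)).enorm
    _ = ∏ j, lintegralL2 (κ.prod κ) (fun z => ‖A j z‖ₑ) :=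
      prod_fin_add_one fun j => lintegralL2 (κ.prod κ) (fun z => ‖A j z‖ₑ)
    _ = _ := Finset.prod_congr rfl fun j _ => lintegralL2_enorm _ (hA j) (hAfin j)

/-- Item 3 of Theorem 6.1: there is a universal constant `C` such that for any Markov
transition density `p` (satisfying Chapman–Kolmogorov w.r.t. a σ-finite reference measure
`m`), with `u(x,y) = ∫₀^∞ p_t(x,y) dt`, `Θ_l`, `Θ_r`, `Φ = Θ_l Θ_r` as in (n2.12), for
every `n ≥ 2` and all finite signed measures `ν j = f j • μ j` (with `|f j| = 1`, so
`|ν j| = μ j`) satisfying `∫∫ Φ d|ν_j| d|ν_j| < ∞`, one has (with `x (n+1) = x 1`)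
`|∫⋯∫ ∏ u(x_j,x_{j+1}) ∏ dν_j| ≤ Cⁿ ∏_j (∫∫ Φ dν_j dν_j)^{1/2}`, and in particular each
double integral on the right-hand side is nonnegative. -/
theorem stmt_5 :
    ∃ C : ℝ, 0 ≤ C ∧
    ∀ (S : Type) [MeasurableSpace S] (m : Measure S) [SigmaFinite m]
      (p : ℝ → S → S → ℝ≥0),
      Measurable (fun q : ℝ × S × S => p q.1 q.2.1 q.2.2) →
      (∀ s s' : ℝ, 0 < s → 0 < s' → ∀ x z : S,
        ∫⁻ y, (p s x y : ℝ≥0∞) * (p s' y z : ℝ≥0∞) ∂m = (p (s + s') x z : ℝ≥0∞)) →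
      ∀ (u Θl Θr Φ : S → S → ℝ≥0∞),
      (∀ x y, u x y = ∫⁻ t in Set.Ioi (0 : ℝ), (p t x y : ℝ≥0∞)) →
      (∀ x y, Θl x y = ∫⁻ s in Set.Ioi (0 : ℝ),
          ∫⁻ v, (p (s / 2) x v : ℝ≥0∞) * (p (s / 2) y v : ℝ≥0∞) ∂m) →
      (∀ x y, Θr x y = ∫⁻ s in Set.Ioi (0 : ℝ),
          ∫⁻ v, (p (s / 2) v x : ℝ≥0∞) * (p (s / 2) v y : ℝ≥0∞) ∂m) →
      (∀ x y, Φ x y = Θl x y * Θr x y) →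
      ∀ (n : ℕ) [NeZero n], 2 ≤ n →
      ∀ (μ : Fin n → Measure S) [∀ j, IsFiniteMeasure (μ j)]
        (f : Fin n → S → ℝ), (∀ j, Measurable (f j)) → (∀ j x, |f j x| = 1) →
      (∀ j, ∫⁻ q : S × S, Φ q.1 q.2 ∂(μ j).prod (μ j) < ⊤) →
      (∀ j, 0 ≤ ∫ q : S × S, (Φ q.1 q.2).toReal * f j q.1 * f j q.2 ∂(μ j).prod (μ j)) ∧
      |∫ x : Fin n → S, (∏ j, (u (x j) (x (j + 1))).toReal) * ∏ j, f j (x j)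
          ∂Measure.pi μ|
        ≤ C ^ n * ∏ j, Real.sqrt
            (∫ q : S × S, (Φ q.1 q.2).toReal * f j q.1 * f j q.2 ∂(μ j).prod (μ j)) := by
  refine ⟨1, zero_le_one, ?_⟩
  intro S _ m _ p hp hCK u Θl Θr Φ hu hΘl hΘr hΦ n _ hn μ _ f hf hf1 hfin
  obtain ⟨n, rfl⟩ : ∃ k, n = k + 2 := ⟨n - 2, by omega⟩
  let κ : Measure (ℝ × S) := (volume.restrict (Set.Ioi (0 : ℝ))).prod m
  let g : ℝ × S → S → ℝ≥0 := fun w x => p (w.1 / 2) w.2 x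
  let h : S → ℝ × S → ℝ≥0 := fun x w => p (w.1 / 2) x w.2
  have hg : Measurable (Function.uncurry g) :=
    hp.comp (by fun_prop : Measurable fun q : (ℝ × S) × S => (q.1.1 / 2, q.1.2, q.2))
  have hh : Measurable (Function.uncurry h) :=
    hp.comp (by fun_prop : Measurable fun q : S × (ℝ × S) => (q.2.1 / 2, q.1, q.2.2))
  have hgx (x : S) : Measurable fun w => (g w x : ℝ≥0∞) :=
    (hg.comp measurable_prodMk_right).coe_nnreal_ennreal
  have hhx (x : S) : Measurable fun w => (h x w : ℝ≥0∞) :=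
    (hh.comp measurable_prodMk_left).coe_nnreal_ennreal
  have hhg (x y : S) : Measurable fun w => (h x w : ℝ≥0∞) * g w y := (hhx x).mul (hgx y)
  have hhh (x y : S) : Measurable fun w => (h x w : ℝ≥0∞) * h y w := (hhx x).mul (hhx y)
  have hgg (x y : S) : Measurable fun w => (g w x : ℝ≥0∞) * g w y := (hgx x).mul (hgx y)
  have hu' (x y) : u x y = ∫⁻ w, (h x w : ℝ≥0∞) * g w y ∂κ := by
    rw [hu, lintegral_prod _ (hhg x y).aemeasurable]
    refine setLIntegral_congr_fun measurableSet_Ioi fun t ht => ?_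
    have ht' : (0 : ℝ) < t / 2 := half_pos ht
    simpa only [add_halves] using (hCK (t / 2) (t / 2) ht' ht' x y).symm
  have hl (x y) : Θl x y = ∫⁻ w, (h x w : ℝ≥0∞) * h y w ∂κ := by
    rw [hΘl, lintegral_prod _ (hhh x y).aemeasurable]
  have hr (x y) : Θr x y = ∫⁻ w, (g w x : ℝ≥0∞) * g w y ∂κ := by
    rw [hΘr, lintegral_prod _ (hgg x y).aemeasurable]
  let k : (ℝ × S) × (ℝ × S) → S → ℝ≥0 := fun w x => g w.1 x * h x w.2
  have hk : Measurable (Function.uncurry k) :=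
    (hg.comp ((measurable_fst.comp measurable_fst).prodMk measurable_snd)).mul
      (hh.comp (measurable_snd.prodMk (measurable_snd.comp measurable_fst)))
  have hΦ' (x y) : Φ x y = ∫⁻ w, (k w x : ℝ≥0∞) * k w y ∂κ.prod κ := by
    rw [hΦ, hl, hr, mul_comm,
      ← lintegral_prod_mul (hgg x y).aemeasurable (hhh x y).aemeasurable]
    refine lintegral_congr fun w => ?_
    simp only [k, ENNReal.coe_mul]
    ring
  simp only [hΦ'] at hfin
  have henergy (j) : ∫ q : S × S, (Φ q.1 q.2).toReal * f j q.1 * f j q.2 ∂(μ j).prod (μ j)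
      = ∫ w, (∫ x, (k w x : ℝ) * f j x ∂μ j) ^ 2 ∂κ.prod κ := by
    simp only [hΦ']
    exact integral_energy_eq (μ j) (κ.prod κ) hk (hf j) (hf1 j) (hfin j)
  simp only [henergy]
  refine ⟨fun j => integral_nonneg fun w => sq_nonneg _, ?_⟩
  rw [one_pow, one_mul]
  simp only [hu']
  refine abs_integral_cyclic_prod_le κ hg hh n μ hf hf1 fun j => ?_
  refine ENNReal.rpow_lt_top_of_nonneg (by norm_num) ?_
  exact ((lintegral_energy_eq (μ j) (κ.prod κ) hk).symm.trans_lt (hfin j)).ne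
end

section
/- Let S be a measurable space and u : S × S → [0,∞] a measurable kernel. For a finite signed Borel measure ν on S set ‖ν‖_0 = max(|ν|(S), sup_x ∫ u(x,y) d|ν|(y)) and ‖ν‖_{u²,∞} = max(|ν|(S), sup_x ∫ (u²(x,y) + u²(y,x)) d|ν|(y)), where |ν| is the total variation measure of ν. Let n ≥ 2, let ν_1, …, ν_n be finite signed Borel measures on S with ‖ν_j‖_0 < ∞ and ‖ν_j‖_{u²,∞} < ∞ for all j, and let A ∪ B be a partition of {1, …, n} with B nonempty. Then |∫⋯∫ u(y_1,y_2) u(y_2,y_3) ⋯ u(y_{n−1},y_n) u(y_n,y_1) ∏_{j=1}^n dν_j(y_j)| ≤ ∏_{i∈A} ‖ν_i‖_0 · ∏_{j∈B} ‖ν_j‖_{u²,∞}. -/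
open MeasureTheory ENNReal

/-- Integrating a product of kernels along a path of distinct indices, starting from its end. -/
theorem lmarginal_prod_path_le {ι S : Type*} [DecidableEq ι] [MeasurableSpace S]
    {u : S → S → ℝ≥0∞} (hu : Measurable (Function.uncurry u))
    (μ : ι → Measure S) [∀ j, SigmaFinite (μ j)] (K : ι → ℝ≥0∞)
    (hmass : ∀ j, μ j Set.univ ≤ K j) (hK : ∀ j x, ∫⁻ y, u x y ∂μ j ≤ K j)
    (c : ℕ → ι) (m : ℕ) (hc : Set.InjOn c (Set.Iic m)) (y : ι → S) :
    (∫⋯∫⁻_(Finset.range (m + 1)).image c,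
        fun z ↦ ∏ i ∈ Finset.range m, u (z (c i)) (z (c (i + 1))) ∂μ) y
      ≤ ∏ i ∈ Finset.range (m + 1), K (c i) := by
  have hmeas (i j : ι) : Measurable fun z : ι → S ↦ u (z i) (z j) :=
    hu.comp (g := Function.uncurry u) (f := fun z : ι → S ↦ (z i, z j)) (by fun_prop)
  induction m generalizing y with
  | zero => simpa [lmarginal_singleton] using hmass (c 0)
  | succ m ih =>
    have hne (i : ℕ) (hi : i ≤ m) : c i ≠ c (m + 1) := fun h ↦ by
      have := hc (Set.mem_Iic.2 (by omega)) (Set.mem_Iic.2 le_rfl) h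
      omega
    have hnot : c (m + 1) ∉ (Finset.range (m + 1)).image c := by
      simp only [Finset.mem_image, Finset.mem_range, not_exists, not_and]
      exact fun i hi ↦ hne i (by omega)
    rw [Finset.range_add_one, Finset.image_insert,
      lmarginal_insert' _ (Finset.measurable_prod _ fun i _ ↦ hmeas _ _) hnot,
      Finset.prod_insert (by simp)]
    calc _ ≤ (∫⋯∫⁻_(Finset.range (m + 1)).image c, fun z ↦ K (c (m + 1)) *
          ∏ i ∈ Finset.range m, u (z (c i)) (z (c (i + 1))) ∂μ) y := by
          refine lmarginal_mono (fun z ↦ ?_) y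
          have hprod (ξ : S) : ∏ i ∈ Finset.range (m + 1),
              u (Function.update z (c (m + 1)) ξ (c i))
                (Function.update z (c (m + 1)) ξ (c (i + 1)))
              = (∏ i ∈ Finset.range m, u (z (c i)) (z (c (i + 1)))) * u (z (c m)) ξ := by
            rw [Finset.prod_range_succ, Function.update_self,
              Function.update_of_ne (hne m le_rfl)]
            congr 1
            refine Finset.prod_congr rfl fun i hi ↦ ?_
            have := Finset.mem_range.1 hi
            rw [Function.update_of_ne (hne i (by omega)),
              Function.update_of_ne (hne (i + 1) (by omega))]
          simp only [hprod]
          rw [lintegral_const_mul _ hu.of_uncurry_left, mul_comm]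
          gcongr
          exact hK _ _
      _ = K (c (m + 1)) * (∫⋯∫⁻_(Finset.range (m + 1)).image c, fun z ↦
          ∏ i ∈ Finset.range m, u (z (c i)) (z (c (i + 1))) ∂μ) y :=
          lintegral_const_mul _ ((Finset.measurable_prod _ fun i _ ↦ hmeas _ _).comp
            measurable_updateFinset)
      _ ≤ _ := by
          gcongr
          exact ih (hc.mono (Set.Iic_subset_Iic.2 (Nat.le_succ m))) y

/-- A cyclic product of kernels, where `k = c (m + 1)` is integrated out first. -/
theorem lintegral_prod_cycle_le {ι S : Type*} [Fintype ι] [DecidableEq ι] [MeasurableSpace S]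
    {u : S → S → ℝ≥0∞} (hu : Measurable (Function.uncurry u))
    (μ : ι → Measure S) [∀ j, SigmaFinite (μ j)] (K : ι → ℝ≥0∞)
    (hmass : ∀ j, μ j Set.univ ≤ K j) (hK : ∀ j x, ∫⁻ y, u x y ∂μ j ≤ K j)
    (c : ℕ → ι) (m : ℕ) (hc : Set.InjOn c (Set.Iic (m + 1)))
    (hsurj : (Finset.range (m + 2)).image c = Finset.univ) (hcycle : c (m + 2) = c 0)
    (hmid : ∀ a b, ∫⁻ y, u a y * u y b ∂μ (c (m + 1)) ≤ K (c (m + 1))) :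
    ∫⁻ z, ∏ i ∈ Finset.range (m + 2), u (z (c i)) (z (c (i + 1))) ∂Measure.pi μ
      ≤ ∏ i ∈ Finset.range (m + 2), K (c i) := by
  have hmeas (i j : ι) : Measurable fun z : ι → S ↦ u (z i) (z j) :=
    hu.comp (g := Function.uncurry u) (f := fun z : ι → S ↦ (z i, z j)) (by fun_prop)
  rcases isEmpty_or_nonempty S with hS | ⟨⟨s⟩⟩
  · have : IsEmpty (ι → S) := ⟨fun z ↦ hS.false (z (c 0))⟩
    simp [Measure.eq_zero_of_isEmpty]
  have hne (i : ℕ) (hi : i ≤ m) : c i ≠ c (m + 1) := fun h ↦ by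
    have := hc (Set.mem_Iic.2 (by omega)) (Set.mem_Iic.2 le_rfl) h
    omega
  have hnot : c (m + 1) ∉ (Finset.range (m + 1)).image c := by
    simp only [Finset.mem_image, Finset.mem_range, not_exists, not_and]
    exact fun i hi ↦ hne i (by omega)
  rw [lintegral_eq_lmarginal_univ (fun _ ↦ s), ← hsurj, Finset.range_add_one,
    Finset.image_insert,
    lmarginal_insert' _ (Finset.measurable_prod _ fun i _ ↦ hmeas _ _) hnot,
    Finset.prod_insert (by simp)]
  calc _ ≤ (∫⋯∫⁻_(Finset.range (m + 1)).image c, fun z ↦ K (c (m + 1)) *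
        ∏ i ∈ Finset.range m, u (z (c i)) (z (c (i + 1))) ∂μ) (fun _ ↦ s) := by
        refine lmarginal_mono (fun z ↦ ?_) _
        have hprod (ξ : S) : ∏ i ∈ Finset.range (m + 2),
            u (Function.update z (c (m + 1)) ξ (c i))
              (Function.update z (c (m + 1)) ξ (c (i + 1)))
            = (∏ i ∈ Finset.range m, u (z (c i)) (z (c (i + 1)))) *
              (u (z (c m)) ξ * u ξ (z (c 0))) := by
          rw [Finset.prod_range_succ, Finset.prod_range_succ, Function.update_self,
            Function.update_of_ne (hne m le_rfl), hcycle,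
            Function.update_of_ne (hne 0 (Nat.zero_le m)), mul_assoc]
          congr 1
          refine Finset.prod_congr rfl fun i hi ↦ ?_
          have := Finset.mem_range.1 hi
          rw [Function.update_of_ne (hne i (by omega)),
            Function.update_of_ne (hne (i + 1) (by omega))]
        simp only [← Finset.range_add_one, hprod]
        rw [lintegral_const_mul _ (hu.of_uncurry_left.fun_mul hu.of_uncurry_right), mul_comm]
        gcongr
        exact hmid _ _
    _ = K (c (m + 1)) * (∫⋯∫⁻_(Finset.range (m + 1)).image c, fun z ↦
        ∏ i ∈ Finset.range m, u (z (c i)) (z (c (i + 1))) ∂μ) (fun _ ↦ s) :=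
        lintegral_const_mul _ ((Finset.measurable_prod _ fun i _ ↦ hmeas _ _).comp
          measurable_updateFinset)
    _ ≤ _ := by
        gcongr
        exact lmarginal_prod_path_le hu μ K hmass hK c m
          (hc.mono (Set.Iic_subset_Iic.2 (Nat.le_succ m))) _

theorem ENNReal.mul_le_half_sq_add_sq (a b : ℝ≥0∞) : a * b ≤ (a ^ 2 + b ^ 2) / 2 := by
  rw [ENNReal.le_div_iff_mul_le (by simp) (by simp), mul_comm, ← mul_assoc]
  rcases eq_or_ne a ⊤ with rfl | ha
  · simp
  rcases eq_or_ne b ⊤ with rfl | hb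
  · simp
  lift a to NNReal using ha
  lift b to NNReal using hb
  exact_mod_cast two_mul_le_add_sq a b

theorem lintegral_mul_le_of_sq_le {S : Type*} [MeasurableSpace S] {μ : Measure S}
    {f g : S → ℝ≥0∞} (hf : Measurable f) {C : ℝ≥0∞}
    (hfC : ∫⁻ x, f x ^ 2 ∂μ ≤ C) (hgC : ∫⁻ x, g x ^ 2 ∂μ ≤ C) :
    ∫⁻ x, f x * g x ∂μ ≤ C := by
  calc ∫⁻ x, f x * g x ∂μ ≤ ∫⁻ x, (f x ^ 2 + g x ^ 2) * 2⁻¹ ∂μ :=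
        lintegral_mono fun x ↦ ENNReal.mul_le_half_sq_add_sq _ _
    _ = (∫⁻ x, f x ^ 2 ∂μ + ∫⁻ x, g x ^ 2 ∂μ) * 2⁻¹ := by
        rw [lintegral_mul_const' _ _ (by simp), lintegral_add_left (hf.pow_const 2)]
    _ ≤ (C + C) * 2⁻¹ := by gcongr
    _ = C := by rw [← two_mul, mul_comm, ← mul_assoc, ENNReal.inv_mul_cancel (by simp) (by simp),
        one_mul]

open MeasureTheory ENNReal

open Fin.CommRing in
theorem Fin.exists_cyclic_enumeration {m : ℕ} (k : Fin (m + 2)) :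
    ∃ c : ℕ → Fin (m + 2), (∀ i, c (i + 1) = c i + 1) ∧ c (m + 1) = k ∧ c (m + 2) = c 0 ∧
      Set.InjOn c (Set.Iic (m + 1)) := by
  have hzero : ((m + 2 : ℕ) : Fin (m + 2)) = 0 := Fin.natCast_self (m + 2)
  refine ⟨fun i ↦ k + 1 + (i : Fin (m + 2)), fun i ↦ ?_, ?_, ?_, fun i hi j hj h ↦ ?_⟩
  · push_cast
    ring
  · push_cast at hzero ⊢
    linear_combination hzero
  · simp only [hzero, Nat.cast_zero]
  · have h := congrArg Fin.val (add_left_cancel h)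
    simp only [Set.mem_Iic] at hi hj
    rwa [Fin.val_cast_of_lt (by omega), Fin.val_cast_of_lt (by omega)] at h

/-- Inequality (bp.5) of Lemma 6.2: for a measurable kernel `u : S × S → [0,∞]`,
finite signed measures `ν j = f j • μ j` (with `|f j| = 1`, so `|ν j| = μ j`) with
`‖ν j‖₀ = max(|ν_j|(S), sup_x ∫ u(x,y) d|ν_j|(y)) < ∞` and
`‖ν j‖_{u²,∞} = max(|ν_j|(S), sup_x ∫ (u²(x,y)+u²(y,x)) d|ν_j|(y)) < ∞`, and a
partition `A ∪ B` of `{1,…,n}` with `B ≠ ∅`, the cyclic kernel integral satisfies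
`|∫⋯∫ u(y₁,y₂)⋯u(y_n,y₁) ∏ dν_j| ≤ ∏_{i∈A} ‖ν_i‖₀ · ∏_{j∈B} ‖ν_j‖_{u²,∞}`. -/
theorem stmt_6 {S : Type*} [MeasurableSpace S]
    (u : S → S → ℝ≥0∞) (hu : Measurable (Function.uncurry u))
    (n : ℕ) (hn : 2 ≤ n) [NeZero n]
    (μ : Fin n → Measure S) [∀ j, IsFiniteMeasure (μ j)]
    (f : Fin n → S → ℝ) (hf_meas : ∀ j, Measurable (f j)) (hf : ∀ j x, |f j x| = 1)
    (h0 : ∀ j, max (μ j Set.univ) (⨆ x, ∫⁻ y, u x y ∂μ j) < ⊤)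
    (h2 : ∀ j, max (μ j Set.univ) (⨆ x, ∫⁻ y, u x y ^ 2 + u y x ^ 2 ∂μ j) < ⊤)
    (A B : Finset (Fin n)) (hAB : Disjoint A B) (hABU : A ∪ B = Finset.univ)
    (hB : B.Nonempty) :
    ENNReal.ofReal
        |∫ y : Fin n → S, (∏ j, (u (y j) (y (j + 1))).toReal) * ∏ j, f j (y j)
          ∂Measure.pi μ|
      ≤ (∏ i ∈ A, max (μ i Set.univ) (⨆ x, ∫⁻ y, u x y ∂μ i)) *
        ∏ j ∈ B, max (μ j Set.univ) (⨆ x, ∫⁻ y, u x y ^ 2 + u y x ^ 2 ∂μ j) := by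
  obtain ⟨k, hk⟩ := hB
  obtain ⟨m, rfl⟩ : ∃ m, n = m + 2 := ⟨n - 2, by omega⟩
  set N₀ : Fin (m + 2) → ℝ≥0∞ := fun i ↦ max (μ i Set.univ) (⨆ x, ∫⁻ y, u x y ∂μ i) with hN₀
  set N₂ : Fin (m + 2) → ℝ≥0∞ :=
    fun i ↦ max (μ i Set.univ) (⨆ x, ∫⁻ y, u x y ^ 2 + u y x ^ 2 ∂μ i) with hN₂
  have hsq (j x) : ∫⁻ y, u x y ^ 2 + u y x ^ 2 ∂μ j ≤ N₂ j :=
    (le_iSup (fun x ↦ ∫⁻ y, u x y ^ 2 + u y x ^ 2 ∂μ j) x).trans (le_max_right _ _)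
  have hsq_left (j x) : ∫⁻ y, u x y ^ 2 ∂μ j ≤ N₂ j :=
    (lintegral_mono fun y ↦ le_self_add).trans (hsq j x)
  have hsq_right (j x) : ∫⁻ y, u y x ^ 2 ∂μ j ≤ N₂ j :=
    (lintegral_mono fun y ↦ le_add_self).trans (hsq j x)
  have hmass₂ (j) : μ j Set.univ ≤ N₂ j := le_max_left _ _
  let K : Fin (m + 2) → ℝ≥0∞ := fun i ↦ if i ∈ A then N₀ i else N₂ i
  have hKA {i} (hi : i ∈ A) : K i = N₀ i := if_pos hi
  have hKB {i} (hi : i ∈ B) : K i = N₂ i := if_neg (Finset.disjoint_right.1 hAB hi)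
  have hmass (j) : μ j Set.univ ≤ K j := by
    by_cases hj : j ∈ A <;> simp [K, hj, hN₀, hN₂]
  have hK (j x) : ∫⁻ y, u x y ∂μ j ≤ K j := by
    by_cases hj : j ∈ A
    · rw [hKA hj]
      exact (le_iSup (fun x ↦ ∫⁻ y, u x y ∂μ j) x).trans (le_max_right _ _)
    · simp only [K, hj, if_false]
      simpa using lintegral_mul_le_of_sq_le (g := fun _ ↦ 1) (hu.of_uncurry_left (x := x))
        (hsq_left j x) (by simpa using hmass₂ j)
  obtain ⟨c, hc_succ, hc_mid, hc_cycle, hc_inj⟩ := Fin.exists_cyclic_enumeration k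
  have hc_surj : (Finset.range (m + 2)).image c = Finset.univ := by
    refine Finset.eq_univ_of_card _ ?_
    rw [Finset.card_image_of_injOn (hc_inj.mono fun i hi ↦ ?_)]
    · simp
    · have := Finset.mem_range.1 hi
      exact Set.mem_Iic.2 (by omega)
  have hc_prod (g : Fin (m + 2) → ℝ≥0∞) :
      ∏ i ∈ Finset.range (m + 2), g (c i) = ∏ j, g j := by
    rw [← hc_surj, Finset.prod_image fun i hi j hj h ↦ hc_inj ?_ ?_ h]
    · have := Finset.mem_range.1 hi
      exact Set.mem_Iic.2 (by omega)
    · have := Finset.mem_range.1 hj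
      exact Set.mem_Iic.2 (by omega)
  have hmain := lintegral_prod_cycle_le hu μ K hmass hK c m hc_inj hc_surj hc_cycle
    fun a b ↦ by
      rw [hc_mid, hKB hk]
      exact lintegral_mul_le_of_sq_le hu.of_uncurry_left (hsq_left k a) (hsq_right k b)
  have hrhs : ∏ j, K j = (∏ i ∈ A, N₀ i) * ∏ j ∈ B, N₂ j := by
    rw [← hABU, Finset.prod_union hAB, Finset.prod_congr rfl fun i hi ↦ hKA hi,
      Finset.prod_congr rfl fun i hi ↦ hKB hi]
  simp only [hc_succ] at hmain
  rw [hc_prod, hrhs] at hmain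
  refine le_trans ?_ hmain
  rw [← Real.enorm_eq_ofReal_abs]
  refine (enorm_integral_le_lintegral_enorm _).trans (lintegral_mono fun z ↦ ?_)
  rw [hc_prod fun j ↦ u (z j) (z (j + 1)), Real.enorm_eq_ofReal_abs, abs_mul, Finset.abs_prod,
    Finset.abs_prod]
  simp only [hf, Finset.prod_const_one, mul_one, abs_of_nonneg ENNReal.toReal_nonneg]
  rw [ENNReal.ofReal_prod_of_nonneg fun _ _ ↦ ENNReal.toReal_nonneg]
  exact Finset.prod_le_prod' fun j _ ↦ ENNReal.ofReal_toReal_le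
end

section
/- Let S be a measurable space and u : S × S → [0,∞] measurable. For a finite signed Borel measure ν on S set ‖ν‖_{ū} = max(|ν|(S), sup_{y,z} |∫ u(y,x) u(x,z) dν(x)|), where |ν| is the total variation measure of ν. Then for every even n ≥ 2 and all finite signed Borel measures ν_1, …, ν_n on S with ‖ν_j‖_{ū} < ∞, one has, with y_{n+1} = y_1, |∫⋯∫ ∏_{j=1}^n u(y_j, y_{j+1}) ∏_{j=1}^n dν_j(y_j)| ≤ ∏_{j=1}^n ‖ν_j‖_{ū}. -/
open MeasureTheory ENNReal

lemma Fin.even_val_add_one_iff {n : ℕ} [NeZero n] (hn : 2 ≤ n) (heven : Even n) (j : Fin n) :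
    Even (j + 1).val ↔ ¬ Even j.val := by
  rw [Fin.val_add, Fin.val_one', Nat.mod_eq_of_lt (show 1 < n by omega), Nat.even_iff,
    Nat.mod_mod_of_dvd _ heven.two_dvd, ← Nat.even_iff, Nat.even_add_one]

lemma Fin.even_val_sub_one_iff {n : ℕ} [NeZero n] (hn : 2 ≤ n) (heven : Even n) (j : Fin n) :
    Even (j - 1).val ↔ ¬ Even j.val := by
  have h := Fin.even_val_add_one_iff hn heven (j - 1)
  rw [sub_add_cancel] at h
  tauto

/-- A product over an even cycle, grouped in pairs around the odd positions. -/
lemma Fin.prod_eq_prod_odd_mul_pred {M : Type*} [CommMonoid M] {n : ℕ} [NeZero n] (hn : 2 ≤ n)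
    (heven : Even n) (a : Fin n → M) :
    ∏ j, a j = ∏ j : {j : Fin n // ¬ Even j.val}, a (j.1 - 1) * a j.1 := by
  rw [← Fintype.prod_subtype_mul_prod_subtype (fun j : Fin n => Even j.val) a,
    Finset.prod_mul_distrib]
  congr 1
  refine Finset.prod_bij' (fun j _ => ⟨j.1 + 1, ?_⟩) (fun j _ => ⟨j.1 - 1, ?_⟩) ?_ ?_ ?_ ?_ ?_
  · rw [Fin.even_val_add_one_iff hn heven]
    exact not_not.2 j.2
  · exact (Fin.even_val_sub_one_iff hn heven _).2 j.2
  all_goals simp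

/-- If, after fixing the coordinates satisfying `p`, an integrand on a finite product factors over
the remaining coordinates, then its integral is bounded by the product of the bounds of the
one-variable integrals and the masses of the measures of the fixed coordinates. -/
lemma MeasureTheory.enorm_integral_pi_le_of_factor {ι S : Type*} [Fintype ι] [MeasurableSpace S]
    (p : ι → Prop) [DecidablePred p] (μ : ι → Measure S) [∀ j, IsFiniteMeasure (μ j)]
    (F : (ι → S) → ℝ)
    (G : ({i // p i} → S) → (i : {i // ¬ p i}) → S → ℝ) (s : ({i // p i} → S) → ℝ)
    (hF : ∀ y : ι → S, F y = s (fun i => y i) * ∏ i : {i // ¬ p i}, G (fun i => y i) i (y i))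
    (hs : ∀ b, ‖s b‖ₑ ≤ 1) (C : ι → ℝ≥0∞)
    (hC : ∀ b (i : {i // ¬ p i}), ‖∫ x, G b i x ∂μ i‖ₑ ≤ C i) :
    ‖∫ y, F y ∂Measure.pi μ‖ₑ
      ≤ (∏ i : {i // p i}, μ i Set.univ) * ∏ i : {i // ¬ p i}, C i := by
  by_cases hint : Integrable F (Measure.pi μ)
  swap
  · simp [integral_undef hint]
  have hmp := (measurePreserving_piEquivPiSubtypeProd μ p).symm
  have hint' := (hmp.integrable_comp_emb (MeasurableEquiv.measurableEmbedding _)).2 hint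
  simp only [Function.comp_def] at hint'
  rw [← hmp.integral_comp' F, integral_prod _ hint']
  refine (enorm_integral_le_lintegral_enorm _).trans ?_
  calc _ ≤ ∫⁻ _ : {i // p i} → S, ∏ i : {i // ¬ p i}, C i ∂Measure.pi fun i : {i // p i} => μ i := by
        refine lintegral_mono fun b => ?_
        have hsec : ∀ a : {i // ¬ p i} → S,
            F ((MeasurableEquiv.piEquivPiSubtypeProd (fun _ => S) p).symm (b, a))
              = s b * ∏ i, G b i (a i) := by
          intro a
          have h1 : (fun i : {i // p i} =>
              (MeasurableEquiv.piEquivPiSubtypeProd (fun _ => S) p).symm (b, a) i) = b := by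
            ext i
            simp [MeasurableEquiv.piEquivPiSubtypeProd, Equiv.piEquivPiSubtypeProd, i.2]
          rw [hF, h1]
          congr 1
          refine Finset.prod_congr rfl fun i _ => ?_
          simp [MeasurableEquiv.piEquivPiSubtypeProd, Equiv.piEquivPiSubtypeProd, i.2]
        simp only [hsec]
        rw [integral_const_mul, integral_fintype_prod_eq_prod (fun i x => G b i x), enorm_mul]
        calc _ ≤ 1 * ‖∏ i : {i // ¬ p i}, ∫ x, G b i x ∂μ i‖ₑ := by gcongr; exact hs b
          _ = ∏ i : {i // ¬ p i}, ‖∫ x, G b i x ∂μ i‖ₑ := by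
            rw [one_mul]
            simp [enorm, nnnorm_prod]
          _ ≤ _ := Finset.prod_le_prod' fun i _ => hC b i
    _ = _ := by rw [lintegral_const, Measure.pi_univ, mul_comm]

/-- Inequality (jh2.22), the even-order case of the π-proper-norm lemma: for a measurable
kernel `u : S × S → [0,∞]`, even `n ≥ 2`, and finite signed measures `ν j = f j • μ j`
(with `|f j| = 1`, so `|ν j| = μ j`) of finite norm
`‖ν‖_ū = max(|ν|(S), sup_{y,z} |∫ u(y,x) u(x,z) dν(x)|)`, one has, with `y (n+1) = y 1`,
`|∫⋯∫ ∏ u(y_j, y_{j+1}) ∏ dν_j| ≤ ∏_j ‖ν_j‖_ū`. -/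
theorem stmt_9 {S : Type*} [MeasurableSpace S]
    (u : S → S → ℝ≥0∞) (hu : Measurable (Function.uncurry u))
    (n : ℕ) (hn : 2 ≤ n) (heven : Even n) [NeZero n]
    (μ : Fin n → Measure S) [∀ j, IsFiniteMeasure (μ j)]
    (f : Fin n → S → ℝ) (hf_meas : ∀ j, Measurable (f j)) (hf : ∀ j x, |f j x| = 1)
    (hnorm : ∀ j, max (μ j Set.univ)
        (⨆ y, ⨆ z, ENNReal.ofReal |∫ x, (u y x * u x z).toReal * f j x ∂μ j|) < ⊤) :
    ENNReal.ofReal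
        |∫ y : Fin n → S, (∏ j, (u (y j) (y (j + 1))).toReal) * ∏ j, f j (y j)
          ∂Measure.pi μ|
      ≤ ∏ j, max (μ j Set.univ)
          (⨆ y, ⨆ z, ENNReal.ofReal |∫ x, (u y x * u x z).toReal * f j x ∂μ j|) := by
  have hsub := fun i : {i : Fin n // ¬ Even i.val} => (Fin.even_val_sub_one_iff hn heven i.1).2 i.2
  have hadd := fun i : {i : Fin n // ¬ Even i.val} => (Fin.even_val_add_one_iff hn heven i.1).2 i.2
  rw [← Real.enorm_eq_ofReal_abs]
  refine (MeasureTheory.enorm_integral_pi_le_of_factor (fun j : Fin n => Even j.val) μ _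
    (fun b i x => (u (b ⟨i.1 - 1, hsub i⟩) x * u x (b ⟨i.1 + 1, hadd i⟩)).toReal * f i.1 x)
    (fun b => ∏ i, f i.1 (b i)) ?_ ?_
    (fun j => ⨆ y, ⨆ z, ENNReal.ofReal |∫ x, (u y x * u x z).toReal * f j x ∂μ j|) ?_).trans ?_
  · intro y
    rw [Fin.prod_eq_prod_odd_mul_pred hn heven,
      ← Fintype.prod_subtype_mul_prod_subtype (fun j : Fin n => Even j.val) (fun j => f j (y j)),
      Finset.prod_mul_distrib]
    simp only [sub_add_cancel, ENNReal.toReal_mul]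
    rw [Finset.prod_mul_distrib, Finset.prod_mul_distrib]
    ring
  · intro b
    simp [Real.enorm_eq_ofReal_abs, Finset.abs_prod, hf]
  · intro b i
    rw [Real.enorm_eq_ofReal_abs]
    exact le_iSup₂_of_le (b ⟨i.1 - 1, hsub i⟩) (b ⟨i.1 + 1, hadd i⟩) le_rfl
  · rw [← Fintype.prod_subtype_mul_prod_subtype (fun j : Fin n => Even j.val)]
    gcongr
    · exact le_max_left _ _
    · exact le_max_right _ _
end

section
/- Let S be a measurable space, u : S × S → [0,∞] a measurable kernel, α > 0, C > 0, and let ν be a finite signed Borel measure on S with a number ‖ν‖ ∈ (0,∞) such that for every n ≥ 2, |∫⋯∫ ∏_{j=1}^n u(x_j, x_{j+1}) ∏_{j=1}^n dν(x_j)| ≤ C^n ‖ν‖^n, where x_{n+1} = x_1 (a weak proper norm bound). Suppose ψ is a real-valued random variable with E[ψ] = 0, E|ψ|^n < ∞ for all n, and for every n ≥ 2, E[ψ^n] = Σ_{π ∈ P'_n} α^{c(π)} ∫⋯∫ ∏_{j=1}^n u(x_j, x_{π(j)}) ∏_{j=1}^n dν(x_j), where P'_n is the set of permutations π of {1,…,n}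 with no fixed point and c(π) is the number of cycles of π. Then E[exp(|ψ|/(2C(max(α,1))^{1/2}‖ν‖))] ≤ 2. -/
open MeasureTheory ENNReal

open Equiv

/-- The integral `∫⋯∫ ∏ w(x_j, x_{σ j}) ∏ f(x_j) dμ(x_j)` attached to a permutation `σ`. -/
noncomputable def permIntegral {S : Type*} [MeasurableSpace S] (μ : Measure S)
    (w : S → S → ℝ) (f : S → ℝ) {ι : Type*} [Fintype ι] (σ : Perm ι) : ℝ :=
  ∫ x : ι → S, (∏ j, w (x j) (x (σ j))) * ∏ j, f (x j) ∂Measure.pi (fun _ => μ)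

section PermIntegral

variable {S : Type*} [MeasurableSpace S] {μ : Measure S} [SigmaFinite μ]
  {w : S → S → ℝ} {f : S → ℝ}

lemma permIntegral_congr {ι κ : Type*} [Fintype ι] [Fintype κ] {σ : Perm ι} {τ : Perm κ}
    (e : ι ≃ κ) (h : ∀ i, e (σ i) = τ (e i)) :
    permIntegral μ w f σ = permIntegral μ w f τ := by
  have hmp := measurePreserving_arrowCongr' (fun _ : ι => μ) (fun _ : κ => μ) e
    (MeasurableEquiv.refl S) (fun _ => MeasurePreserving.id μ)
  rw [permIntegral, permIntegral, ← hmp.map_eq, integral_map_equiv]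
  refine integral_congr_ae (.of_forall fun x => ?_)
  have hx : ∀ i, MeasurableEquiv.arrowCongr' e (MeasurableEquiv.refl S) x (e i) = x i := by
    intro i
    simp [MeasurableEquiv.arrowCongr', Equiv.arrowCongr', Equiv.arrowCongr]
  simp only [← e.prod_comp, ← h, hx]

lemma permIntegral_eq_mul {ι : Type*} [Fintype ι] (σ : Perm ι) (p : ι → Prop) [DecidablePred p]
    (hp : ∀ i, p (σ i) ↔ p i) :
    permIntegral μ w f σ = permIntegral μ w f (σ.subtypePerm hp) *
      permIntegral μ w f (σ.subtypePerm (p := fun i => ¬ p i) fun i => not_congr (hp i)) := by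
  have hmp := (measurePreserving_piEquivPiSubtypeProd (fun _ : ι => μ) p).symm
  rw [permIntegral, ← hmp.map_eq, integral_map_equiv, permIntegral, permIntegral,
    ← integral_prod_mul]
  refine integral_congr_ae (.of_forall fun x => ?_)
  obtain ⟨y, rfl⟩ := (MeasurableEquiv.piEquivPiSubtypeProd (fun _ : ι => S) p).surjective x
  simp only [MeasurableEquiv.symm_apply_apply]
  rw [← Fintype.prod_subtype_mul_prod_subtype p, ← Fintype.prod_subtype_mul_prod_subtype p,
    mul_mul_mul_comm]
  rfl

/-- A fixed-point free permutation with a single orbit is conjugate to a rotation. -/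
lemma exists_equiv_finRotate {ι : Type*} [Fintype ι] (σ : Perm ι) (a : ι)
    (hne : ∀ i, σ i ≠ i) (hσ : ∀ i, σ.SameCycle a i) :
    ∃ (n : ℕ) (e : ι ≃ Fin (n + 2)), ∀ i, e (σ i) = e i + 1 := by
  classical
  have hcard : 2 ≤ Fintype.card ι := Fintype.one_lt_card_iff.2 ⟨σ a, a, hne a⟩
  obtain ⟨n, hn⟩ := Nat.exists_eq_add_of_le' hcard
  let e₀ : ι ≃ Fin (n + 2) := Fintype.equivFinOfCardEq hn
  have hcyc : σ.IsCycle := ⟨a, hne a, fun i _ => hσ i⟩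
  have hsupp : (e₀.permCongr σ).support = Finset.univ := by
    ext i
    simp only [Perm.mem_support, permCongr_apply, Finset.mem_univ, iff_true]
    intro h
    exact hne (e₀.symm i) (e₀.eq_symm_apply.2 h)
  have hcyc' : (e₀.permCongr σ).IsCycle := by
    refine ⟨e₀ a, by simpa using hne a, fun i _ => ?_⟩
    obtain ⟨k, hk⟩ := hσ (e₀.symm i)
    refine ⟨k, ?_⟩
    have : (e₀.permCongr σ) ^ k = e₀.permCongr (σ ^ k) := (map_zpow e₀.permCongrHom σ k).symm
    simp [this, hk]
  obtain ⟨c, hc⟩ := isConj_iff.1 (hcyc'.isConj (isCycle_finRotate (n := n))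
    (by rw [hsupp, support_finRotate]))
  refine ⟨n, e₀.trans c, fun i => ?_⟩
  have := congrArg (fun g : Perm (Fin (n + 2)) => g (c (e₀ i))) hc
  simpa using this

lemma abs_permIntegral_le {B : ℝ}
    (hB : ∀ n : ℕ, |permIntegral μ w f (finRotate (n + 2))| ≤ B ^ (n + 2))
    {ι : Type*} [Fintype ι] (σ : Perm ι) (hσ : ∀ i, σ i ≠ i) :
    |permIntegral μ w f σ| ≤ B ^ Fintype.card ι := by
  classical
  induction h : Fintype.card ι using Nat.strong_induction_on generalizing ι with
  | _ m ih =>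
    subst h
    rcases isEmpty_or_nonempty ι with hι | ⟨⟨a⟩⟩
    · simp [permIntegral, measureReal_def]
    · have hp : ∀ i, σ.SameCycle a (σ i) ↔ σ.SameCycle a i := fun i => Perm.sameCycle_apply_right
      have hcard : Fintype.card ι = Fintype.card {i // σ.SameCycle a i} +
          Fintype.card {i // ¬ σ.SameCycle a i} := by
        rw [Fintype.card_subtype_compl, Nat.add_sub_cancel' (Fintype.card_subtype_le _)]
      rw [permIntegral_eq_mul σ (σ.SameCycle a) hp, abs_mul, hcard, pow_add]
      have hcycle : |permIntegral μ w f (σ.subtypePerm hp)| ≤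
          B ^ Fintype.card {i // σ.SameCycle a i} := by
        obtain ⟨n, e, he⟩ := exists_equiv_finRotate (σ.subtypePerm hp) ⟨a, .refl _ _⟩
          (fun i hi => hσ i (congrArg Subtype.val hi)) fun i => Perm.sameCycle_subtypePerm.2 i.2
        rw [permIntegral_congr (τ := finRotate (n + 2)) e (by simpa using he),
          Fintype.card_congr e, Fintype.card_fin]
        exact hB n
      refine mul_le_mul hcycle (ih _ ?_ _ (fun i hi => hσ i (congrArg Subtype.val hi)) rfl)
        (abs_nonneg _) ((abs_nonneg _).trans hcycle)
      exact Fintype.card_subtype_lt (x := a) (not_not_intro (.refl _ _))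

end PermIntegral

/-- The number of cycles of a permutation is at most half the number of points. -/
lemma two_mul_card_cycleType_le {ι : Type*} [Fintype ι] [DecidableEq ι] (σ : Perm ι) :
    2 * σ.cycleType.card ≤ Fintype.card ι := by
  have h := Multiset.card_nsmul_le_sum (s := σ.cycleType) (a := 2)
    fun _ hn => Perm.two_le_of_mem_cycleType hn
  rw [Perm.sum_cycleType, smul_eq_mul, mul_comm] at h
  exact h.trans (Finset.card_le_univ _)

lemma exp_abs_half_le (x : ℝ) :
    Real.exp (|x| / 2) ≤ 5 / 4 + 1 / 2 * x ^ 2 +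
      ∑' k : ℕ, 2 * (x / 2) ^ (2 * (k + 2)) / (2 * (k + 2)).factorial := by
  have hs := (hasSum_nat_add_iff' 2).2 (Real.hasSum_cosh (x / 2))
  have ht : ∑' k : ℕ, 2 * (x / 2) ^ (2 * (k + 2)) / (2 * (k + 2)).factorial =
      2 * (Real.cosh (x / 2) - (1 + (x / 2) ^ 2 / 2)) := by
    simp only [mul_div_assoc, tsum_mul_left, hs.tsum_eq]
    norm_num [Finset.sum_range_succ]
  have hc : Real.cosh (x / 2) = (Real.exp (|x| / 2) + Real.exp (-(|x| / 2))) / 2 := by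
    rw [← Real.cosh_eq, ← Real.cosh_abs (x / 2), abs_div, abs_two]
  have he := Real.add_one_le_exp (-(|x| / 2))
  rw [ht, hc]
  nlinarith [sq_abs x, sq_nonneg (|x| - 1)]

lemma summable_exp_abs_half (x : ℝ) :
    Summable fun k : ℕ => 2 * (x / 2) ^ (2 * (k + 2)) / (2 * (k + 2)).factorial := by
  simpa only [mul_div_assoc] using
    ((hasSum_nat_add_iff' 2).2 (Real.hasSum_cosh (x / 2))).summable.mul_left 2

/-- Factorial growth of the even moments bounds an exponential moment. -/
lemma lintegral_exp_abs_half_le_two {Ω : Type*} [MeasurableSpace Ω] {P : Measure Ω}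
    [IsProbabilityMeasure P] {X : Ω → ℝ} (hX : Measurable X)
    (hint : ∀ k : ℕ, Integrable (fun ω => X ω ^ (2 * k)) P)
    (h2 : ∫ ω, X ω ^ 2 ∂P ≤ 1)
    (hmom : ∀ k : ℕ, 2 ≤ k → ∫ ω, X ω ^ (2 * k) ∂P ≤ (2 * k).factorial) :
    ∫⁻ ω, ENNReal.ofReal (Real.exp (|X ω| / 2)) ∂P ≤ 2 := by
  have hnn : ∀ (k : ℕ) (x : ℝ),
      0 ≤ 2 * (x / 2) ^ (2 * (k + 2)) / (2 * (k + 2)).factorial := fun k x => by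
    have := (even_two_mul (k + 2)).pow_nonneg (x / 2)
    positivity
  have hint2 : Integrable (fun ω => 5 / 4 + 1 / 2 * X ω ^ 2) P :=
    (integrable_const _).add ((hint 1).const_mul _)
  have hlow : ∫⁻ ω, ENNReal.ofReal (5 / 4 + 1 / 2 * X ω ^ 2) ∂P ≤ ENNReal.ofReal (7 / 4) := by
    rw [← ofReal_integral_eq_lintegral_ofReal hint2 (.of_forall fun ω => by positivity)]
    refine ENNReal.ofReal_le_ofReal ?_
    rw [integral_add (integrable_const _) ((hint 1).const_mul _), integral_const_mul]
    simp only [integral_const, probReal_univ, one_smul]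
    linarith
  have hterm : ∀ k : ℕ, ∫⁻ ω, ENNReal.ofReal
      (2 * (X ω / 2) ^ (2 * (k + 2)) / (2 * (k + 2)).factorial) ∂P ≤
        ENNReal.ofReal (1 / 8 * (1 / 4) ^ k) := fun k => by
    have heq : ∀ ω, 2 * (X ω / 2) ^ (2 * (k + 2)) / (2 * (k + 2)).factorial =
        1 / 8 * (1 / 4) ^ k / (2 * (k + 2)).factorial * X ω ^ (2 * (k + 2)) := fun ω => by
      rw [div_pow, pow_mul 2 2, pow_add, one_div_pow]
      field_simp
      ring
    rw [← ofReal_integral_eq_lintegral_ofReal (by simpa only [heq] using (hint (k + 2)).const_mul _)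
      (.of_forall fun ω => hnn k _)]
    refine ENNReal.ofReal_le_ofReal ?_
    simp only [heq]
    rw [integral_const_mul, div_mul_eq_mul_div, div_le_iff₀ (by positivity)]
    gcongr
    exact hmom (k + 2) (by lia)
  have hsum : HasSum (fun k : ℕ => (1 / 8 : ℝ) * (1 / 4) ^ k) (1 / 8 * (1 - 1 / 4)⁻¹) :=
    (hasSum_geometric_of_lt_one (by norm_num) (by norm_num)).mul_left _
  calc
    ∫⁻ ω, ENNReal.ofReal (Real.exp (|X ω| / 2)) ∂P
      ≤ ∫⁻ ω, (ENNReal.ofReal (5 / 4 + 1 / 2 * X ω ^ 2) + ∑' k : ℕ, ENNReal.ofReal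
          (2 * (X ω / 2) ^ (2 * (k + 2)) / (2 * (k + 2)).factorial)) ∂P := by
        refine lintegral_mono fun ω => ?_
        dsimp only
        rw [← ENNReal.ofReal_tsum_of_nonneg (fun k => hnn k _) (summable_exp_abs_half _),
          ← ENNReal.ofReal_add (by positivity) (tsum_nonneg fun k => hnn k _)]
        exact ENNReal.ofReal_le_ofReal (exp_abs_half_le _)
    _ = ∫⁻ ω, ENNReal.ofReal (5 / 4 + 1 / 2 * X ω ^ 2) ∂P + ∑' k : ℕ, ∫⁻ ω, ENNReal.ofReal
          (2 * (X ω / 2) ^ (2 * (k + 2)) / (2 * (k + 2)).factorial) ∂P := by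
        rw [lintegral_add_left (by fun_prop), lintegral_tsum fun k => by fun_prop]
    _ ≤ ENNReal.ofReal (7 / 4) + ∑' k : ℕ, ENNReal.ofReal (1 / 8 * (1 / 4) ^ k) := by
        gcongr with k
        exact hterm k
    _ ≤ 2 := by
        rw [← ENNReal.ofReal_tsum_of_nonneg (fun k => by positivity) hsum.summable, hsum.tsum_eq,
          ← ENNReal.ofReal_add (by norm_num) (by norm_num), ← ENNReal.ofReal_ofNat]
        exact ENNReal.ofReal_le_ofReal (by norm_num)

/-- A weighted sum over derangements of terms of size at most `M`. -/
lemma sum_derangements_le {k : ℕ} {α M : ℝ} (hα : 0 < α)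
    {I : Perm (Fin (2 * k)) → ℝ} (hM : ∀ π : Perm (Fin (2 * k)), (∀ j, π j ≠ j) → |I π| ≤ M) :
    ∑ π ∈ Finset.univ.filter (fun π : Perm (Fin (2 * k)) => ∀ j, π j ≠ j),
        α ^ π.cycleType.card * I π ≤
      (Finset.univ.filter (fun π : Perm (Fin (2 * k)) => ∀ j, π j ≠ j)).card *
        (max α 1 ^ k * M) := by
  rw [← nsmul_eq_mul]
  refine Finset.sum_le_card_nsmul _ _ _ fun π hπ => ?_
  have hk : π.cycleType.card ≤ k := by
    have := two_mul_card_cycleType_le π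
    rw [Fintype.card_fin] at this
    lia
  have hpow : α ^ π.cycleType.card ≤ max α 1 ^ k :=
    (pow_le_pow_left₀ hα.le (le_max_left _ _) _).trans (pow_le_pow_right₀ (le_max_right _ _) hk)
  exact (mul_le_mul_of_nonneg_left (le_abs_self _) (by positivity)).trans
    (mul_le_mul hpow (hM π (Finset.mem_filter.1 hπ).2) (abs_nonneg _) (by positivity))

/-- Lemma 3.2 (cor-2.1): let `ν = f • μ` (with `|f| = 1`, so `|ν| = μ`) be a finite
signed measure with weak proper norm bound
`|∫⋯∫ ∏ u(x_j, x_{j+1}) ∏ dν(x_j)| ≤ Cⁿ ‖ν‖ⁿ` for all `n ≥ 2` (cyclically,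
`x (n+1) = x 1`), and let `ψ` be a centered random variable with all moments finite
whose `n`-th moments (`n ≥ 2`) are given by the α-permanental moment formula
`E[ψⁿ] = Σ_{π fixed-point free} α^{c(π)} ∫⋯∫ ∏ u(x_j, x_{π j}) ∏ dν(x_j)`.
Then `E[exp(|ψ| / (2C (max α 1)^{1/2} ‖ν‖))] ≤ 2`. -/
theorem stmt_12 {S : Type*} [MeasurableSpace S]
    (u : S → S → ℝ≥0∞) (hu : Measurable (Function.uncurry u))
    (α C : ℝ) (hα : 0 < α) (hC : 0 < C)
    (μ : Measure S) [IsFiniteMeasure μ]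
    (f : S → ℝ) (hf_meas : Measurable f) (hf : ∀ x, |f x| = 1)
    (N : ℝ) (hN : 0 < N)
    (hweak : ∀ (n : ℕ) [NeZero n], 2 ≤ n →
      |∫ x : Fin n → S, (∏ j, (u (x j) (x (j + 1))).toReal) * ∏ j, f (x j)
          ∂Measure.pi (fun _ => μ)| ≤ C ^ n * N ^ n)
    {Ω : Type*} [MeasurableSpace Ω] (P : Measure Ω) [IsProbabilityMeasure P]
    (ψ : Ω → ℝ) (hψ_meas : Measurable ψ)
    (hmean : ∫ ω, ψ ω ∂P = 0)
    (hint : ∀ n : ℕ, Integrable (fun ω => |ψ ω| ^ n) P)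
    (hmoment : ∀ n : ℕ, 2 ≤ n →
      ∫ ω, ψ ω ^ n ∂P =
        ∑ π ∈ Finset.univ.filter (fun π : Equiv.Perm (Fin n) => ∀ j, π j ≠ j),
          α ^ π.cycleType.card *
            ∫ x : Fin n → S, (∏ j, (u (x j) (x (π j))).toReal) * ∏ j, f (x j)
              ∂Measure.pi (fun _ => μ)) :
    ∫⁻ ω, ENNReal.ofReal
        (Real.exp (|ψ ω| / (2 * C * Real.sqrt (max α 1) * N))) ∂P ≤ 2 := by
  set K : ℝ := C * Real.sqrt (max α 1) * N with hK
  have hK0 : 0 < K := by positivity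
  have hKpow : ∀ k : ℕ, K ^ (2 * k) = max α 1 ^ k * (C * N) ^ (2 * k) := fun k => by
    rw [hK, mul_right_comm, mul_pow, pow_mul (√_) 2, Real.sq_sqrt (by positivity), mul_comm]
  have hrot : ∀ n : ℕ, |permIntegral μ (fun x y => (u x y).toReal) f (finRotate (n + 2))| ≤
      (C * N) ^ (n + 2) := fun n => by
    simpa [permIntegral, mul_pow] using hweak (n + 2) (by lia)
  have hmom : ∀ k : ℕ, 1 ≤ k → ∫ ω, (ψ ω / K) ^ (2 * k) ∂P ≤
      (Finset.univ.filter (fun π : Perm (Fin (2 * k)) => ∀ j, π j ≠ j)).card := fun k hk => by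
    simp only [div_pow]
    rw [integral_div, div_le_iff₀ (by positivity), hmoment (2 * k) (by lia), hKpow]
    refine sum_derangements_le hα fun π hπ => ?_
    simpa [permIntegral] using abs_permIntegral_le hrot π hπ
  have hmain := lintegral_exp_abs_half_le_two (P := P) (X := fun ω => ψ ω / K)
    (hψ_meas.div_const K) (fun k => ?_) ?_ fun k hk => ?_
  · refine le_of_eq_of_le (lintegral_congr fun ω => ?_) hmain
    rw [abs_div, abs_of_pos hK0, div_div, hK]
    ring_nf
  · simpa only [div_pow, (even_two_mul k).pow_abs] using (hint (2 * k)).div_const (K ^ (2 * k))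
  · refine (hmom 1 le_rfl).trans ?_
    have : (Finset.univ.filter (fun π : Perm (Fin 2) => ∀ j, π j ≠ j)).card = 1 := by decide
    exact_mod_cast this.le
  · refine (hmom k (by lia)).trans ?_
    have := Finset.card_filter_le (Finset.univ : Finset (Perm (Fin (2 * k)))) fun π => ∀ j, π j ≠ j
    rw [Finset.card_univ, Fintype.card_perm, Fintype.card_fin] at this
    exact_mod_cast this
end
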